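/- Let n ≥ 5, p > 1 and γ ∈ (1, 3/2). Set E(p,γ) = p(1 − 4(γ−1)²) − γ²/(2γ−1) + 8γ²(γ−1)²/((4γ−3+p)(p+1)). If E(p,γ) > 0 and p + 2γ − 1 > (p−1)n/4, then there is no stable classical solution of Δ²u = u^p, u > 0, on ℝⁿ. -/

import Mathlib

open MeasureTheory Real RealInnerProductSpace

/-- The Laplacian of `f : ℝⁿ → ℝ`, as the trace of the second derivative. -/
noncomputable def lap {n : ℕ} (f : EuclideanSpace ℝ (Fin n) → ℝ)
    (x : EuclideanSpace ℝ (Fin n)) : ℝ :=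
  ∑ i : Fin n,
    iteratedFDeriv ℝ 2 f x ![EuclideanSpace.single i 1, EuclideanSpace.single i 1]

/-- Squared Frobenius norm of the Hessian of `f : ℝⁿ → ℝ`. -/
noncomputable def hessNormSq {n : ℕ} (f : EuclideanSpace ℝ (Fin n) → ℝ)
    (x : EuclideanSpace ℝ (Fin n)) : ℝ :=
  ∑ i : Fin n, ∑ j : Fin n,
    (iteratedFDeriv ℝ 2 f x ![EuclideanSpace.single i 1, EuclideanSpace.single j 1]) ^ 2

/-- The quantity `‖∇⁴(φ^{2γ})‖` defined by
`‖∇⁴(φ^{2γ})‖² = φ^{-2γ}|∇φ^γ|⁴ + |φ^γ Δ²φ^γ| + |∇²φ^γ|²`,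
with the first term interpreted as `0` where `φ = 0`. -/
noncomputable def norm4 {n : ℕ} (γ : ℝ) (φ : EuclideanSpace ℝ (Fin n) → ℝ)
    (x : EuclideanSpace ℝ (Fin n)) : ℝ :=
  Real.sqrt
    ((if φ x = 0 then 0 else φ x ^ (-(2*γ)) * ‖gradient (fun y => φ y ^ γ) x‖ ^ 4)
      + |φ x ^ γ * lap (lap (fun y => φ y ^ γ)) x|
      + hessNormSq (fun y => φ y ^ γ) x)

/-! ### Partial derivatives -/

section PartialDerivatives

variable {n : ℕ}

/-- The `i`-th partial derivative of a function on `ℝⁿ`. -/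
noncomputable def pd (i : Fin n) (f : EuclideanSpace ℝ (Fin n) → ℝ)
    (x : EuclideanSpace ℝ (Fin n)) : ℝ :=
  fderiv ℝ f x (EuclideanSpace.single i 1)

variable {f g : EuclideanSpace ℝ (Fin n) → ℝ} {x : EuclideanSpace ℝ (Fin n)} {i j : Fin n}

lemma ContDiff.pd {k m : WithTop ℕ∞} (hf : ContDiff ℝ m f) (h : k + 1 ≤ m) (i : Fin n) :
    ContDiff ℝ k (pd i f) :=
  (hf.fderiv_right h).clm_apply contDiff_const

lemma HasCompactSupport.pd (hf : HasCompactSupport f) (i : Fin n) :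
    HasCompactSupport (pd i f) :=
  hf.fderiv_apply ℝ _

lemma pd_add (hf : DifferentiableAt ℝ f x) (hg : DifferentiableAt ℝ g x) :
    pd i (fun y => f y + g y) x = pd i f x + pd i g x := by
  simp only [pd]
  rw [fderiv_fun_add hf hg]; rfl

lemma pd_mul (hf : DifferentiableAt ℝ f x) (hg : DifferentiableAt ℝ g x) :
    pd i (fun y => f y * g y) x = f x * pd i g x + g x * pd i f x := by
  simp only [pd]
  rw [fderiv_fun_mul hf hg]; rfl

lemma pd_const_mul (c : ℝ) (hf : DifferentiableAt ℝ f x) :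
    pd i (fun y => c * f y) x = c * pd i f x := by
  simp only [pd]
  rw [fderiv_const_mul hf]; rfl

lemma pd_sum {ι : Type*} (s : Finset ι) {F : ι → EuclideanSpace ℝ (Fin n) → ℝ}
    (hF : ∀ k ∈ s, DifferentiableAt ℝ (F k) x) :
    pd i (fun y => ∑ k ∈ s, F k y) x = ∑ k ∈ s, pd i (F k) x := by
  simp only [pd]
  rw [fderiv_fun_sum hF]
  simp

lemma pd_comp {h : ℝ → ℝ} {h' : ℝ} (hh : HasDerivAt h h' (f x)) (hf : DifferentiableAt ℝ f x) :
    pd i (fun y => h (f y)) x = h' * pd i f x := by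
  have := (hh.comp_hasFDerivAt x hf.hasFDerivAt).fderiv
  simp only [pd]
  rw [show (fun y => h (f y)) = h ∘ f from rfl, this]; rfl

/-- Product rule against an exponential weight. -/
lemma pd_exp_mul (c : ℝ) (hf : DifferentiableAt ℝ f x) (hg : DifferentiableAt ℝ g x) :
    pd i (fun y => exp (c * f y) * g y) x =
      exp (c * f x) * (c * pd i f x * g x + pd i g x) := by
  have h1 : HasDerivAt (fun t : ℝ => exp (c * t)) (exp (c * f x) * c) (f x) := by
    simpa using ((hasDerivAt_id (f x)).const_mul c).exp
  have h2 : DifferentiableAt ℝ (fun y => exp (c * f y)) x := (hf.const_mul c).exp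
  rw [pd_mul h2 hg, pd_comp h1 hf]; ring

lemma pd_pd_comm (hf : ContDiff ℝ 2 f) (i j : Fin n) : pd i (pd j f) = pd j (pd i f) := by
  have key : ∀ (a b : Fin n) (y : EuclideanSpace ℝ (Fin n)), pd a (pd b f) y =
      fderiv ℝ (fderiv ℝ f) y (EuclideanSpace.single a 1) (EuclideanSpace.single b 1) := by
    intro a b y
    have hd : DifferentiableAt ℝ (fderiv ℝ f) y :=
      ((hf.fderiv_right (m := 1) (by norm_num)).differentiable (by norm_num)) y
    change fderiv ℝ (fun z => fderiv ℝ f z (EuclideanSpace.single b 1)) y _ = _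
    rw [fderiv_clm_apply hd (differentiableAt_const _)]
    simp
  funext y
  rw [key, key]
  exact (hf.contDiffAt.isSymmSndFDerivAt (by simp)).eq _ _

lemma lap_eq_sum_pd (hf : ContDiff ℝ 2 f) : lap f = fun x => ∑ i, pd i (pd i f) x := by
  funext y
  simp only [lap]
  refine Finset.sum_congr rfl fun a _ => ?_
  have hd : DifferentiableAt ℝ (fderiv ℝ f) y :=
    ((hf.fderiv_right (m := 1) (by norm_num)).differentiable (by norm_num)) y
  rw [iteratedFDeriv_two_apply]
  change _ = fderiv ℝ (fun z => fderiv ℝ f z (EuclideanSpace.single a 1)) y _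
  rw [fderiv_clm_apply hd (differentiableAt_const _)]
  simp

lemma ContDiff.lap {k m : WithTop ℕ∞} (hf : ContDiff ℝ m f) (h : k + 2 ≤ m) :
    ContDiff ℝ k (lap f) := by
  rw [lap_eq_sum_pd (hf.of_le (le_trans (by simp) h))]
  exact ContDiff.sum fun i _ =>
    (hf.pd (k := k + 1) (by rwa [add_assoc, one_add_one_eq_two]) i).pd le_rfl i

lemma HasCompactSupport.lap (hf : HasCompactSupport f) : HasCompactSupport (lap f) := by
  have h := hf.iteratedFDeriv (𝕜 := ℝ) 2
  refine h.mono' fun y hy => ?_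
  by_contra hn
  apply hy
  have : _root_.iteratedFDeriv ℝ 2 f y = 0 := image_eq_zero_of_notMem_tsupport hn
  simp [_root_.lap, this]

/-! ### Integration by parts -/

lemma integral_mul_pd (hf : ContDiff ℝ 1 f) (hg : ContDiff ℝ 1 g)
    (hc : HasCompactSupport f ∨ HasCompactSupport g) (i : Fin n) :
    ∫ x, f x * pd i g x = - ∫ x, pd i f x * g x := by
  have cf : Continuous (pd i f) := (hf.pd (k := 0) (by norm_num) i).continuous
  have cg : Continuous (pd i g) := (hg.pd (k := 0) (by norm_num) i).continuous
  refine integral_mul_fderiv_eq_neg_fderiv_mul_of_integrable ?_ ?_ ?_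
    (fun x _ => hf.differentiable (by norm_num) x) (fun x _ => hg.differentiable (by norm_num) x)
  · refine (cf.mul hg.continuous).integrable_of_hasCompactSupport ?_
    rcases hc with h | h
    exacts [(h.pd i).mul_right, h.mul_left]
  · refine (hf.continuous.mul cg).integrable_of_hasCompactSupport ?_
    rcases hc with h | h
    exacts [h.mul_right, (h.pd i).mul_left]
  · refine (hf.continuous.mul hg.continuous).integrable_of_hasCompactSupport ?_
    rcases hc with h | h
    exacts [h.mul_right, h.mul_left]

lemma integral_pd_eq_zero (hf : ContDiff ℝ 1 f) (hc : HasCompactSupport f) (i : Fin n) :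
    ∫ x, pd i f x = 0 := by
  have := integral_mul_pd (f := fun _ => (1 : ℝ)) contDiff_const hf (Or.inr hc) i
  have h0 : ∀ x, pd i (fun _ : EuclideanSpace ℝ (Fin n) => (1 : ℝ)) x = 0 := fun x => by simp [pd]
  simpa [h0] using this

lemma integral_sum_pd_eq_zero {X : Fin n → EuclideanSpace ℝ (Fin n) → ℝ}
    (hX : ∀ i, ContDiff ℝ 1 (X i)) (hc : ∀ i, HasCompactSupport (X i)) :
    ∫ x, ∑ i, pd i (X i) x = 0 := by
  rw [integral_finsetSum]
  · exact Finset.sum_eq_zero fun i _ => integral_pd_eq_zero (hX i) (hc i) i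
  · exact fun i _ => ((hX i).pd (k := 0) (by norm_num) i).continuous.integrable_of_hasCompactSupport
      ((hc i).pd i)

lemma integral_mul_lap (hf : ContDiff ℝ 2 f) (hg : ContDiff ℝ 2 g) (hc : HasCompactSupport f) :
    ∫ x, f x * lap g x = ∫ x, lap f x * g x := by
  have e1 : (1 : WithTop ℕ∞) ≤ 2 := by norm_num
  have e2 : (1 : WithTop ℕ∞) + 1 ≤ 2 := by norm_num
  have e3 : (0 : WithTop ℕ∞) + 1 ≤ 1 := by norm_num
  rw [lap_eq_sum_pd hf, lap_eq_sum_pd hg]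
  simp only [Finset.mul_sum, Finset.sum_mul]
  rw [integral_finsetSum, integral_finsetSum]
  · refine Finset.sum_congr rfl fun i _ => ?_
    have a1 := integral_mul_pd (hf.of_le e1) (hg.pd e2 i) (Or.inl hc) i
    have a2 := integral_mul_pd (hf.pd e2 i) (hg.of_le e1) (Or.inl (hc.pd i)) i
    rw [a1, a2, neg_neg]
  · exact fun i _ => (((hf.pd e2 i).pd e3 i).continuous.mul
      hg.continuous).integrable_of_hasCompactSupport ((hc.pd i).pd i).mul_right
  · exact fun i _ => (hf.continuous.mul
      ((hg.pd e2 i).pd e3 i).continuous).integrable_of_hasCompactSupport hc.mul_right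

lemma hasCompactSupport_sum {ι : Type*} [Fintype ι] {F : ι → EuclideanSpace ℝ (Fin n) → ℝ}
    (hF : ∀ k, HasCompactSupport (F k)) : HasCompactSupport fun x => ∑ k, F k x := by
  classical
  have : ∀ s : Finset ι, HasCompactSupport fun x => ∑ k ∈ s, F k x := by
    intro s
    induction s using Finset.induction_on with
    | empty => simp only [Finset.sum_empty]; exact HasCompactSupport.zero
    | insert a s ha ih =>
      simp only [Finset.sum_insert ha]
      exact (hF a).add ih
  exact this _

lemma integral_lap_sq (hf : ContDiff ℝ 3 f) (hc : HasCompactSupport f) :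
    ∫ x, (lap f x) ^ 2 = ∫ x, ∑ i, ∑ j, (pd i (pd j f) x) ^ 2 := by
  have e1 : (1 : WithTop ℕ∞) ≤ 2 := by norm_num
  have e2 : (1 : WithTop ℕ∞) + 1 ≤ 2 := by norm_num
  have e3 : (2 : WithTop ℕ∞) + 1 ≤ 3 := by norm_num
  have e4 : (2 : WithTop ℕ∞) ≤ 3 := by norm_num
  have d1 : ∀ i, ContDiff ℝ 2 (pd i f) := fun i => hf.pd e3 i
  have d2 : ∀ i j, ContDiff ℝ 1 (pd i (pd j f)) := fun i j => (d1 j).pd e2 i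
  have c2 : ∀ i j, HasCompactSupport (pd i (pd j f)) := fun i j => (hc.pd j).pd i
  rw [lap_eq_sum_pd (hf.of_le e4)]
  simp only [sq, Finset.sum_mul_sum]
  rw [integral_finsetSum, integral_finsetSum]
  · refine Finset.sum_congr rfl fun i _ => ?_
    rw [integral_finsetSum, integral_finsetSum]
    · refine Finset.sum_congr rfl fun j _ => ?_
      have a1 := integral_mul_pd (d2 j j) ((d1 i).of_le e1) (Or.inl (c2 j j)) i
      have a2 := integral_mul_pd (d2 i j) ((d1 i).of_le e1) (Or.inl (c2 i j)) j
      have a3 : pd i (pd j (pd j f)) = pd j (pd i (pd j f)) := pd_pd_comm (d1 j) i j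
      have a4 : pd i (pd j f) = pd j (pd i f) := pd_pd_comm (hf.of_le e4) i j
      calc ∫ x, pd i (pd i f) x * pd j (pd j f) x = ∫ x, pd j (pd j f) x * pd i (pd i f) x := by
            simp only [mul_comm]
        _ = ∫ x, pd i (pd j f) x * pd j (pd i f) x := by rw [a1, a2, a3]
        _ = _ := by rw [← a4]
    · exact fun j _ => ((d2 i j).continuous.mul
        (d2 i j).continuous).integrable_of_hasCompactSupport (c2 i j).mul_right
    · exact fun j _ => ((d2 i i).continuous.mul
        (d2 j j).continuous).integrable_of_hasCompactSupport (c2 i i).mul_right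
  · exact fun i _ => (continuous_finsetSum _ fun j _ => (d2 i j).continuous.mul
        (d2 i j).continuous).integrable_of_hasCompactSupport
          (hasCompactSupport_sum fun j => (c2 i j).mul_right)
  · exact fun i _ => (continuous_finsetSum _ fun j _ => (d2 i i).continuous.mul
        (d2 j j).continuous).integrable_of_hasCompactSupport
          (hasCompactSupport_sum fun j => (c2 i i).mul_right)

end PartialDerivatives

/-! ### Stability against test functions of finite regularity -/

section Mollification

open Filter Topology Convolution

variable {n : ℕ} {f : EuclideanSpace ℝ (Fin n) → ℝ}

lemma pd_mollify (b : ContDiffBump (0 : EuclideanSpace ℝ (Fin n))) (hf : ContDiff ℝ 1 f)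
    (hc : HasCompactSupport f) (i : Fin n) :
    pd i (b.normed volume ⋆[ContinuousLinearMap.lsmul ℝ ℝ, volume] f) =
      b.normed volume ⋆[ContinuousLinearMap.lsmul ℝ ℝ, volume] pd i f := by
  funext x
  have hb : LocallyIntegrable (b.normed volume) volume :=
    b.continuous_normed.locallyIntegrable
  have h := (hc.hasFDerivAt_convolution_right (ContinuousLinearMap.lsmul ℝ ℝ) hb hf x).fderiv
  rw [pd, h, convolution_precompR_apply _ hb (hc.fderiv ℝ) (hf.continuous_fderiv (by norm_num))]
  rfl

lemma lap_mollify (b : ContDiffBump (0 : EuclideanSpace ℝ (Fin n))) (hf : ContDiff ℝ 2 f)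
    (hc : HasCompactSupport f) :
    lap (b.normed volume ⋆[ContinuousLinearMap.lsmul ℝ ℝ, volume] f) =
      b.normed volume ⋆[ContinuousLinearMap.lsmul ℝ ℝ, volume] lap f := by
  have hb : LocallyIntegrable (b.normed volume) volume :=
    b.continuous_normed.locallyIntegrable
  have h1 : ContDiff ℝ 2 (b.normed volume ⋆[ContinuousLinearMap.lsmul ℝ ℝ, volume] f) :=
    b.hasCompactSupport_normed.contDiff_convolution_left _
      (n := 2) (b.contDiff_normed) hf.continuous.locallyIntegrable
  rw [lap_eq_sum_pd h1, lap_eq_sum_pd hf]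
  funext x
  have hd : ∀ i, ContDiff ℝ 1 (pd i f) := fun i => hf.pd (by norm_num) i
  simp only [fun i => pd_mollify b (hf.of_le (by norm_num)) hc i,
    fun i => pd_mollify b (hd i) (hc.pd i) i, convolution, ContinuousLinearMap.lsmul_apply,
    smul_eq_mul, Finset.mul_sum]
  rw [integral_finsetSum]
  intro i _
  have := ((hc.pd i).pd i).convolutionExists_right (ContinuousLinearMap.lsmul ℝ ℝ) hb
    ((hd i).pd (k := 0) (by norm_num) i).continuous x
  simpa [ConvolutionExistsAt] using this

lemma exists_mollify_bound (hf : Continuous f) (hc : HasCompactSupport f) :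
    ∃ R M : ℝ, 0 ≤ M ∧ ∀ b : ContDiffBump (0 : EuclideanSpace ℝ (Fin n)), b.rOut ≤ 1 → ∀ x,
      |(b.normed volume ⋆[ContinuousLinearMap.lsmul ℝ ℝ, volume] f) x| ≤
        (Metric.closedBall 0 R).indicator (fun _ => M) x := by
  obtain ⟨M, hM⟩ := hc.exists_bound_of_continuous hf
  obtain ⟨R, hR⟩ := hc.isCompact.isBounded.subset_closedBall (0 : EuclideanSpace ℝ (Fin n))
  have hM0 : 0 ≤ M := (norm_nonneg _).trans (hM 0)
  refine ⟨R + 1, 3 * M, by positivity, fun b hb x => ?_⟩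
  by_cases hx : x ∈ Metric.closedBall (0 : EuclideanSpace ℝ (Fin n)) (R + 1)
  · rw [Set.indicator_of_mem hx]
    have h := b.dist_normed_convolution_le (μ := volume) (x₀ := x) (g := f) (ε := 2 * M)
      hf.aestronglyMeasurable (fun y _ => by
        rw [dist_eq_norm]
        linarith [norm_sub_le (f y) (f x), hM x, hM y])
    rw [Real.dist_eq] at h
    have h2 := abs_sub_abs_le_abs_sub
      ((b.normed volume ⋆[ContinuousLinearMap.lsmul ℝ ℝ, volume] f) x) (f x)
    have h3 : |f x| ≤ M := hM x
    linarith
  · rw [Set.indicator_of_notMem hx]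
    have hz : ∀ y ∈ Metric.ball x (1 : ℝ), f y = 0 := by
      intro y hy
      by_contra hne
      have hy2 := hR (subset_tsupport f hne)
      rw [Metric.mem_closedBall, dist_zero_right] at hx hy2
      rw [Metric.mem_ball, dist_eq_norm] at hy
      have h4 := norm_sub_norm_le x y
      rw [norm_sub_rev] at h4
      linarith
    have hx0 : f x = 0 := hz x (Metric.mem_ball_self one_pos)
    have h := b.dist_normed_convolution_le (μ := volume) (x₀ := x) (g := f) (ε := 0)
      hf.aestronglyMeasurable (fun y hy => by
        rw [hx0, hz y (Metric.ball_subset_ball hb hy), dist_self])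
    rw [hx0, Real.dist_eq, sub_zero] at h
    exact h

lemma stable_of_smooth {V : EuclideanSpace ℝ (Fin n) → ℝ} (hV : Continuous V)
    (hstab : ∀ φ : EuclideanSpace ℝ (Fin n) → ℝ, ContDiff ℝ (⊤ : ℕ∞) φ → HasCompactSupport φ →
      ∫ x, V x * φ x ^ 2 ≤ ∫ x, (lap φ x) ^ 2)
    (hf : ContDiff ℝ 2 f) (hc : HasCompactSupport f) :
    ∫ x, V x * f x ^ 2 ≤ ∫ x, (lap f x) ^ 2 := by
  let b : ℕ → ContDiffBump (0 : EuclideanSpace ℝ (Fin n)) := fun k =>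
    { rIn := 1 / (2 * ((k : ℝ) + 1)), rOut := 1 / ((k : ℝ) + 1), rIn_pos := by positivity
      rIn_lt_rOut := by
        apply one_div_lt_one_div_of_lt <;> nlinarith [Nat.cast_nonneg (α := ℝ) k] }
  have hb1 : ∀ k, (b k).rOut ≤ 1 := fun k => by
    change 1 / ((k : ℝ) + 1) ≤ 1
    rw [div_le_one (by positivity)]
    linarith [Nat.cast_nonneg (α := ℝ) k]
  have hb0 : Tendsto (fun k => (b k).rOut) atTop (𝓝 0) := tendsto_one_div_add_atTop_nhds_zero_nat
  have hl : Continuous (lap f) := (hf.lap (k := 0) (by norm_num)).continuous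
  set F : ℕ → EuclideanSpace ℝ (Fin n) → ℝ := fun k =>
    (b k).normed volume ⋆[ContinuousLinearMap.lsmul ℝ ℝ, volume] f with hF
  set G : ℕ → EuclideanSpace ℝ (Fin n) → ℝ := fun k =>
    (b k).normed volume ⋆[ContinuousLinearMap.lsmul ℝ ℝ, volume] lap f with hG
  have hFs : ∀ k, ContDiff ℝ (⊤ : ℕ∞) (F k) := fun k =>
    (b k).hasCompactSupport_normed.contDiff_convolution_left _ (b k).contDiff_normed
      hf.continuous.locallyIntegrable
  have hGs : ∀ k, Continuous (G k) := fun k =>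
    ((b k).hasCompactSupport_normed.contDiff_convolution_left (n := 0) _ (b k).contDiff_normed
      hl.locallyIntegrable).continuous
  have hFc : ∀ k, HasCompactSupport (F k) := fun k =>
    (b k).hasCompactSupport_normed.convolution _ hc
  have hle : ∀ k, ∫ x, V x * F k x ^ 2 ≤ ∫ x, (G k x) ^ 2 := by
    intro k
    have := hstab (F k) (hFs k) (hFc k)
    rwa [hF, lap_mollify (b k) hf hc] at this
  have key : ∀ (W : EuclideanSpace ℝ (Fin n) → ℝ) (g : EuclideanSpace ℝ (Fin n) → ℝ),
      Continuous W → Continuous g → HasCompactSupport g →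
      (∀ k, Continuous ((b k).normed volume ⋆[ContinuousLinearMap.lsmul ℝ ℝ, volume] g)) →
      Tendsto (fun k => ∫ x, W x *
        ((b k).normed volume ⋆[ContinuousLinearMap.lsmul ℝ ℝ, volume] g) x ^ 2) atTop
        (𝓝 (∫ x, W x * g x ^ 2)) := by
    intro W g hW hg hgc hcont
    obtain ⟨R, M, hM, hbd⟩ := exists_mollify_bound hg hgc
    refine tendsto_integral_of_dominated_convergence
      ((Metric.closedBall 0 R).indicator (fun x => |W x| * M ^ 2)) ?_ ?_ ?_ ?_
    · exact fun k => (hW.mul ((hcont k).pow 2)).aestronglyMeasurable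
    · rw [integrable_indicator_iff measurableSet_closedBall]
      exact (hW.abs.mul continuous_const).continuousOn.integrableOn_compact
        (isCompact_closedBall _ _)
    · refine fun k => Eventually.of_forall fun x => ?_
      have h := hbd (b k) (hb1 k) x
      rw [norm_mul, norm_pow, Real.norm_eq_abs, Real.norm_eq_abs]
      by_cases hx : x ∈ Metric.closedBall (0 : EuclideanSpace ℝ (Fin n)) R
      · rw [Set.indicator_of_mem hx] at h ⊢
        gcongr
      · rw [Set.indicator_of_notMem hx] at h ⊢
        have h0 := le_antisymm h (abs_nonneg _)
        rw [h0]; simp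
    · exact Eventually.of_forall fun x =>
        ((ContDiffBump.convolution_tendsto_right_of_continuous hb0 hg x).pow 2).const_mul _
  have t1 := key V f hV hf.continuous hc fun k => (hFs k).continuous
  have t2 := key (fun _ => 1) (lap f) continuous_const hl hc.lap hGs
  simp only [one_mul] at t2
  exact le_of_tendsto_of_tendsto' t1 t2 hle

end Mollification

/-! ### The pointwise algebra behind the integral estimate -/

section PointwiseAlgebra

/-- Young's inequality for the lower order terms. -/
lemma lower_order_young {ε : ℝ} (hε : 0 < ε) :
    ∃ C : ℝ, 0 ≤ C ∧ ∀ X b d y τ : ℝ, 0 ≤ X → 0 ≤ τ → d ^ 2 ≤ X * τ →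
      X * τ ≤ ε * (X ^ 2 + b ^ 2 + y ^ 2) + C * τ ^ 2 ∧
      |b| * τ ≤ ε * (X ^ 2 + b ^ 2 + y ^ 2) + C * τ ^ 2 ∧
      |X * d| ≤ ε * (X ^ 2 + b ^ 2 + y ^ 2) + C * τ ^ 2 ∧
      |y * d| ≤ ε * (X ^ 2 + b ^ 2 + y ^ 2) + C * τ ^ 2 := by
  have hY : ∀ (e s t : ℝ), 0 < e → s * t ≤ e * s ^ 2 + 1 / (4 * e) * t ^ 2 := by
    intro e s t he
    have h : 0 ≤ (2 * e * s - t) ^ 2 / (4 * e) := by positivity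
    have h2 : (2 * e * s - t) ^ 2 / (4 * e) = e * s ^ 2 - s * t + 1 / (4 * e) * t ^ 2 := by
      field_simp; ring
    linarith
  refine ⟨1 / (4 * ε) + 1 / (2 * ε) * (1 / (4 * ε ^ 2)), by positivity,
    fun X b d y τ hX hτ hd => ?_⟩
  have hq : 0 ≤ 1 / (2 * ε) * (1 / (4 * ε ^ 2)) * τ ^ 2 := by positivity
  have hq' : 0 ≤ 1 / (4 * ε) * τ ^ 2 := by positivity
  have hX2 : 0 ≤ ε * X ^ 2 := by positivity
  have hb2 : 0 ≤ ε * b ^ 2 := by positivity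
  have hy2 : 0 ≤ ε * y ^ 2 := by positivity
  have hd2 : 1 / (2 * ε) * d ^ 2 ≤ ε / 2 * X ^ 2 + 1 / (2 * ε) * (1 / (4 * ε ^ 2)) * τ ^ 2 := by
    have h1 := hY (ε ^ 2) X τ (by positivity)
    have h2 : 1 / (2 * ε) * d ^ 2 ≤ 1 / (2 * ε) * (ε ^ 2 * X ^ 2 + 1 / (4 * ε ^ 2) * τ ^ 2) :=
      mul_le_mul_of_nonneg_left (hd.trans h1) (by positivity)
    calc _ ≤ _ := h2
      _ = _ := by field_simp
  have hYd : ∀ s : ℝ, |s * d| ≤ ε / 2 * s ^ 2 + 1 / (2 * ε) * d ^ 2 := by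
    intro s
    have h := hY (ε / 2) |s| |d| (by positivity)
    rw [sq_abs, sq_abs, ← abs_mul] at h
    calc _ ≤ _ := h
      _ = _ := by ring
  refine ⟨?_, ?_, ?_, ?_⟩
  · linarith [hY ε X τ hε]
  · have := hY ε |b| τ hε
    rw [sq_abs] at this
    linarith
  · linarith [hYd X]
  · linarith [hYd y]

/-- Absorption of the small terms. -/
lemma absorb_small_terms {p E κ C₀ C₁ : ℝ} (hp : 0 < p) (hE : 0 < E) (hκ : 0 < κ) (hC₀ : 0 ≤ C₀)
    (hC₁ : 0 ≤ C₁) :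
    ∃ ε : ℝ, 0 < ε ∧ ∀ C : ℝ, ∃ c C' m a : ℝ, 0 < c ∧ 0 ≤ m ∧ ∀ X b y τ h l l' : ℝ,
      E * y ^ 2 + κ * (h - p * y ^ 2) ≤ l + ε * (X ^ 2 + b ^ 2 + y ^ 2) + C * τ ^ 2 →
      X ^ 2 ≤ l' + C₁ * h + C * τ ^ 2 →
      b ^ 2 ≤ C₀ * (h + X ^ 2 + τ ^ 2) →
      c * (y ^ 2 + b ^ 2) ≤ C' * τ ^ 2 - m * (h - p * y ^ 2) + l + a * l' := by
  set C₂ := C₁ + C₀ * (1 + C₁) with hC₂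
  have hC₂0 : 0 ≤ C₂ := by positivity
  set ε := min (E / (4 * (C₂ * p + 1))) (κ / (2 * (C₂ + 1))) with hεdef
  have hε : 0 < ε := by
    apply lt_min <;> positivity
  have h1 : ε * (C₂ * p + 1) ≤ E / 4 := by
    calc ε * (C₂ * p + 1) ≤ E / (4 * (C₂ * p + 1)) * (C₂ * p + 1) :=
          mul_le_mul_of_nonneg_right (min_le_left _ _) (by positivity)
      _ = E / 4 := by field_simp
  have h2 : ε * C₂ ≤ κ / 2 := by
    calc ε * C₂ ≤ ε * (C₂ + 1) := by nlinarith
      _ ≤ κ / (2 * (C₂ + 1)) * (C₂ + 1) :=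
          mul_le_mul_of_nonneg_right (min_le_right _ _) (by positivity)
      _ = κ / 2 := by field_simp
  refine ⟨ε, hε, fun C => ⟨min (E / 2) ε, C + 2 * ε * (C + C₀ * (C + 1)), κ - 2 * ε * C₂,
    2 * ε * (1 + C₀), lt_min (by positivity) hε, by linarith, ?_⟩⟩
  intro X b y τ h l l' H1 H2 H3
  have H4 : b ^ 2 ≤ C₀ * (h + (l' + C₁ * h + C * τ ^ 2) + τ ^ 2) :=
    H3.trans (mul_le_mul_of_nonneg_left (by linarith) hC₀)
  have H5 : ε * (X ^ 2 + b ^ 2) ≤ ε * (C₂ * h + (1 + C₀) * l' + (C + C₀ * (C + 1)) * τ ^ 2) := by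
    refine mul_le_mul_of_nonneg_left ?_ hε.le
    rw [hC₂]
    linarith
  have h3 : ε * (C₂ * p + 1) * y ^ 2 ≤ E / 4 * y ^ 2 :=
    mul_le_mul_of_nonneg_right h1 (sq_nonneg _)
  have h4 : min (E / 2) ε * y ^ 2 ≤ E / 2 * y ^ 2 :=
    mul_le_mul_of_nonneg_right (min_le_left _ _) (sq_nonneg _)
  have h5 : min (E / 2) ε * b ^ 2 ≤ ε * b ^ 2 :=
    mul_le_mul_of_nonneg_right (min_le_right _ _) (sq_nonneg _)
  have h6 : 0 ≤ ε * X ^ 2 := by positivity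
  have h7 : 0 ≤ ε * y ^ 2 := by positivity
  nlinarith [h3, h4, h5, h6, h7, H5, H1]

/-- The expansion of the bilaplacian term. -/
lemma bilaplacian_term_le {γ ε : ℝ} (hγ : 1 ≤ γ) (hε : 0 < ε) :
    ∃ C : ℝ, ∀ X b d y τ K e : ℝ, 0 ≤ X → 0 ≤ τ → d ^ 2 ≤ X * τ → |K| ≤ τ → |e| ≤ |b| * τ →
      (γ * b + γ * (γ - 1) * X + 2 * γ * d + K) ^ 2 ≤
        γ ^ 2 / (2 * γ - 1) * (((2 * γ - 1) * (2 * γ - 2) * (X * b) + (2 * γ - 1) * b ^ 2 +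
          4 * (2 * γ - 1) * (b * d) + 2 * e + 2 * (b * K) - y ^ 2) + y ^ 2) +
        γ ^ 2 * (γ - 1) ^ 2 * X ^ 2 + ε * (X ^ 2 + b ^ 2 + y ^ 2) + C * τ ^ 2 := by
  have hc : 0 < 2 * γ - 1 := by linarith
  set q := 2 * γ ^ 2 / (2 * γ - 1) with hq
  have hq0 : 0 ≤ q := by positivity
  set m := 4 * γ ^ 2 * (γ - 1) + 2 * γ + 2 * γ * (γ - 1) + 8 * γ ^ 2 + 2 * q with hm
  have hm0 : 0 < m := by
    have : 0 ≤ γ - 1 := by linarith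
    positivity
  obtain ⟨C, hC, H⟩ := lower_order_young (div_pos hε hm0)
  refine ⟨m * C + 2, fun X b d y τ K e hX hτ hd hK he => ?_⟩
  obtain ⟨h1, h2, h3, -⟩ := H X b d y τ hX hτ hd
  set B := ε / m * (X ^ 2 + b ^ 2 + y ^ 2) + C * τ ^ 2 with hB
  have hbK : |b * K| ≤ B := by
    rw [abs_mul]
    exact (mul_le_mul_of_nonneg_left hK (abs_nonneg _)).trans h2
  have hXK : |X * K| ≤ B := by
    rw [abs_mul, abs_of_nonneg hX]
    exact (mul_le_mul_of_nonneg_left hK hX).trans h1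
  have hee : |e| ≤ B := he.trans h2
  have hdd : d ^ 2 ≤ B := hd.trans h1
  have hKK : K ^ 2 ≤ τ ^ 2 := by
    rw [← sq_abs K]; gcongr
  have hmB : m * B = ε * (X ^ 2 + b ^ 2 + y ^ 2) + m * C * τ ^ 2 := by
    rw [hB]; field_simp
  have hid : (γ * b + γ * (γ - 1) * X + 2 * γ * d + K) ^ 2 =
      γ ^ 2 / (2 * γ - 1) * (((2 * γ - 1) * (2 * γ - 2) * (X * b) + (2 * γ - 1) * b ^ 2 +
          4 * (2 * γ - 1) * (b * d) + 2 * e + 2 * (b * K) - y ^ 2) + y ^ 2) +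
        γ ^ 2 * (γ - 1) ^ 2 * X ^ 2 + (4 * γ ^ 2 * (γ - 1) * (X * d) + 2 * γ * (b * K) +
        2 * γ * (γ - 1) * (X * K) + (2 * γ * d + K) ^ 2 - q * (e + b * K)) := by
    have hk : γ ^ 2 / (2 * γ - 1) * (2 * γ - 1) = γ ^ 2 := div_mul_cancel₀ _ hc.ne'
    have hq2 : q = 2 * (γ ^ 2 / (2 * γ - 1)) := by rw [hq]; ring
    rw [hq2]
    linear_combination (-((2 * γ - 2) * (X * b) + b ^ 2 + 4 * (b * d))) * hk
  have hsq : (2 * γ * d + K) ^ 2 ≤ 8 * γ ^ 2 * d ^ 2 + 2 * K ^ 2 := by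
    nlinarith [sq_nonneg (2 * γ * d - K)]
  have i1 : 4 * γ ^ 2 * (γ - 1) * (X * d) ≤ 4 * γ ^ 2 * (γ - 1) * B :=
    mul_le_mul_of_nonneg_left ((le_abs_self _).trans h3)
      (mul_nonneg (by positivity) (by linarith))
  have i2 : 2 * γ * (b * K) ≤ 2 * γ * B :=
    mul_le_mul_of_nonneg_left ((le_abs_self _).trans hbK) (by linarith)
  have i3 : 2 * γ * (γ - 1) * (X * K) ≤ 2 * γ * (γ - 1) * B :=
    mul_le_mul_of_nonneg_left ((le_abs_self _).trans hXK) (mul_nonneg (by linarith) (by linarith))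
  have i4 : 8 * γ ^ 2 * d ^ 2 ≤ 8 * γ ^ 2 * B := mul_le_mul_of_nonneg_left hdd (by positivity)
  have i5 : - (q * (e + b * K)) ≤ q * (2 * B) := by
    rw [← mul_neg]
    refine mul_le_mul_of_nonneg_left ?_ hq0
    linarith [neg_abs_le e, neg_abs_le (b * K)]
  have hmB' : m * B = 4 * γ ^ 2 * (γ - 1) * B + 2 * γ * B + 2 * γ * (γ - 1) * B +
      8 * γ ^ 2 * B + q * (2 * B) := by rw [hm]; ring
  rw [hid]
  linarith

/-- The fourth power of the gradient is controlled by the Hessian. -/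
lemma gradient_term_le {γ ε : ℝ} (hγ : 1 ≤ γ) (hε : 0 < ε) :
    ∃ C : ℝ, ∀ X b d y τ Φ M N : ℝ, 0 ≤ X → 0 ≤ τ → d ^ 2 ≤ X * τ → 0 ≤ N →
      Φ ^ 2 ≤ N * X ^ 2 → |M| ≤ X * τ →
      X ^ 2 / 2 ≤ - (-X ^ 2 + X * b - 2 * (X * d) + 2 / γ * (Φ - M)) + X * b +
        2 / γ ^ 2 * N + ε * (X ^ 2 + b ^ 2 + y ^ 2) + C * τ ^ 2 := by
  have hγ0 : 0 < γ := by linarith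
  obtain ⟨C, hC, H⟩ := lower_order_young (show 0 < ε / (2 + 2 / γ) by positivity)
  refine ⟨(2 + 2 / γ) * C, fun X b d y τ Φ M N hX hτ hd hN hΦ hM => ?_⟩
  obtain ⟨h1, -, h3, -⟩ := H X b d y τ hX hτ hd
  set B := ε / (2 + 2 / γ) * (X ^ 2 + b ^ 2 + y ^ 2) + C * τ ^ 2 with hB
  have hmB : (2 + 2 / γ) * B = ε * (X ^ 2 + b ^ 2 + y ^ 2) + (2 + 2 / γ) * C * τ ^ 2 := by
    rw [hB]
    have : 2 + 2 / γ ≠ 0 := by positivity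
    field_simp
  have hΦ2 : 2 / γ * Φ ≤ X ^ 2 / 2 + 2 / γ ^ 2 * N := by
    have h0 : 0 ≤ X ^ 2 / 2 + 2 / γ ^ 2 * N := by positivity
    refine le_of_abs_le (abs_le_of_sq_le_sq ?_ h0)
    have h5 : (2 / γ * Φ) ^ 2 ≤ 4 / γ ^ 2 * (N * X ^ 2) := by
      rw [mul_pow]
      calc (2 / γ) ^ 2 * Φ ^ 2 ≤ (2 / γ) ^ 2 * (N * X ^ 2) :=
            mul_le_mul_of_nonneg_left hΦ (by positivity)
        _ = _ := by ring
    have h6 : (X ^ 2 / 2 + 2 / γ ^ 2 * N) ^ 2 =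
      (X ^ 2 / 2 - 2 / γ ^ 2 * N) ^ 2 + 4 / γ ^ 2 * (N * X ^ 2) := by ring
    rw [h6]
    linarith [sq_nonneg (X ^ 2 / 2 - 2 / γ ^ 2 * N)]
  have hM2 : - (2 / γ * M) ≤ 2 / γ * B := by
    rw [← mul_neg]
    exact mul_le_mul_of_nonneg_left (((neg_le_abs M).trans hM).trans h1) (by positivity)
  have hXd : - (2 * (X * d)) ≤ 2 * B := by linarith [neg_abs_le (X * d)]
  have e1 : 2 / γ * (Φ - M) = 2 / γ * Φ - 2 / γ * M := by ring
  have e2 : (2 + 2 / γ) * B = 2 * B + 2 / γ * B := by ring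
  linarith

lemma laplacian_term_le {γ : ℝ} (hγ : 1 ≤ γ) :
    ∃ C : ℝ, 0 ≤ C ∧ ∀ X b d τ K : ℝ, 0 ≤ X → 0 ≤ τ → d ^ 2 ≤ X * τ → |K| ≤ τ →
      b ^ 2 ≤ C * ((γ * b + γ * (γ - 1) * X + 2 * γ * d + K) ^ 2 + X ^ 2 + τ ^ 2) := by
  refine ⟨4 * (1 + (γ * (γ - 1)) ^ 2 + (2 * γ) ^ 2 + 1), by positivity,
    fun X b d τ K hX hτ hd hK => ?_⟩
  set h := γ * b + γ * (γ - 1) * X + 2 * γ * d + K with hh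
  have hKK : K ^ 2 ≤ τ ^ 2 := by
    rw [← sq_abs K]; gcongr
  have hd2 : d ^ 2 ≤ X ^ 2 + τ ^ 2 := by nlinarith [sq_nonneg (X - τ), sq_nonneg X, sq_nonneg τ]
  have hb : b ^ 2 ≤ (γ * b) ^ 2 := by
    rw [mul_pow]
    exact le_mul_of_one_le_left (sq_nonneg b) (one_le_pow₀ hγ)
  have h4 : (γ * b) ^ 2 ≤
      4 * (h ^ 2 + (γ * (γ - 1)) ^ 2 * X ^ 2 + (2 * γ) ^ 2 * d ^ 2 + K ^ 2) := by
    have : γ * b = h - γ * (γ - 1) * X - 2 * γ * d - K := by rw [hh]; ring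
    rw [this]
    nlinarith [sq_nonneg (h + γ * (γ - 1) * X), sq_nonneg (h + 2 * γ * d), sq_nonneg (h + K),
      sq_nonneg (γ * (γ - 1) * X - 2 * γ * d), sq_nonneg (γ * (γ - 1) * X - K),
      sq_nonneg (2 * γ * d - K)]
  have h5 : (2 * γ) ^ 2 * d ^ 2 ≤ (2 * γ) ^ 2 * (X ^ 2 + τ ^ 2) :=
    mul_le_mul_of_nonneg_left hd2 (by positivity)
  have p1 : 0 ≤ (γ * (γ - 1)) ^ 2 * (h ^ 2 + τ ^ 2) := by positivity
  have p2 : 0 ≤ (2 * γ) ^ 2 * h ^ 2 := by positivity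
  nlinarith [sq_nonneg X, sq_nonneg h, sq_nonneg τ]

/-- The pointwise inequality for exponent `γ = 1`, requiring no sign of the Laplacian. -/
lemma pointwise_core_one {p : ℝ} (hp : 1 < p) :
    ∃ c C m m₂ m₃ m₄ : ℝ, 0 < c ∧ 0 ≤ m ∧ ∀ X b d y τ K e Φ M N : ℝ,
      0 ≤ X → 0 ≤ τ → d ^ 2 ≤ X * τ → |K| ≤ τ → |e| ≤ |b| * τ → 0 ≤ N →
      Φ ^ 2 ≤ N * X ^ 2 → |M| ≤ X * τ →
      c * (y ^ 2 + b ^ 2) ≤ C * τ ^ 2 - m * ((b + 2 * d + K) ^ 2 - p * y ^ 2) +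
        m₂ * (N - (b + 2 * d + K) ^ 2) +
        m₃ * (b ^ 2 + 4 * (b * d) + 2 * e + 2 * (b * K) - y ^ 2) +
        m₄ * (-X ^ 2 + X * b - 2 * (X * d) + 2 * (Φ - M)) := by
  obtain ⟨ε, hε, H⟩ := absorb_small_terms (p := p) (E := p - 1) (κ := 1) (C₀ := 16) (C₁ := 200)
    (by linarith) (by linarith) one_pos (by norm_num) (by norm_num)
  obtain ⟨Ca, ha⟩ := bilaplacian_term_le (le_refl (1 : ℝ)) hε
  obtain ⟨Cb, hb⟩ := gradient_term_le (le_refl (1 : ℝ)) (ε := 1 / 16) (by norm_num)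
  set C := max Ca (8 * Cb + 1000000) with hC
  obtain ⟨c, C', m, a, hc, hm, H⟩ := H C
  refine ⟨c, C', m, 16 * a, 1, -(8 * a), hc, hm,
    fun X b d y τ K e Φ M N hX hτ hd hK he hN hΦ hM => ?_⟩
  have ha' := ha X b d y τ K e hX hτ hd hK he
  have hb' := hb X b d 0 τ Φ M N hX hτ hd hN hΦ hM
  have hKK : K ^ 2 ≤ τ ^ 2 := by
    rw [← sq_abs K]; gcongr
  have hCa : Ca * τ ^ 2 ≤ C * τ ^ 2 := mul_le_mul_of_nonneg_right (le_max_left _ _) (sq_nonneg _)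
  have hCb : (8 * Cb + 1000000) * τ ^ 2 ≤ C * τ ^ 2 :=
    mul_le_mul_of_nonneg_right (le_max_right _ _) (sq_nonneg _)
  norm_num at ha' hb'
  set h := b + 2 * d + K with hh
  have hbb : b ^ 2 ≤ 3 * (h ^ 2 + 4 * d ^ 2 + K ^ 2) := by
    have : b = h - 2 * d - K := by rw [hh]; ring
    rw [this]
    nlinarith [sq_nonneg (h + 2 * d), sq_nonneg (h + K), sq_nonneg (2 * d - K)]
  have hXt : X * τ ≤ 1 / 1000 * X ^ 2 + 250 * τ ^ 2 := by nlinarith [sq_nonneg (X - 500 * τ)]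
  have hd4 : 4 * d ^ 2 ≤ 4 * (X * τ) := by linarith
  have hXb : X * b ≤ 1 / 16 * X ^ 2 + 4 * b ^ 2 := by nlinarith [sq_nonneg (X - 8 * b)]
  have hXt2 : X * τ ≤ 1 / 2 * X ^ 2 + 1 / 2 * τ ^ 2 := by nlinarith [sq_nonneg (X - τ)]
  have hX2 := sq_nonneg X
  have hh2 := sq_nonneg h
  have hτ2 := sq_nonneg τ
  have H' := H X b y τ (h ^ 2) (b ^ 2 + 4 * (b * d) + 2 * e + 2 * (b * K) - y ^ 2)
    (16 * (N - h ^ 2) - 8 * (-X ^ 2 + X * b - 2 * (X * d) + 2 * (Φ - M)))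
    (by linarith) (by linarith) (by linarith)
  linarith

set_option maxHeartbeats 1000000 in
/-- The pointwise inequality for exponent `γ`, where the Laplacian has a sign. -/
lemma pointwise_core {p γ : ℝ} (hp : 1 < p) (hγ1 : 1 < γ) (hγ2 : γ < 3/2)
    (hE : 0 < p*(1 - 4*(γ-1)^2) - γ^2/(2*γ-1) + 8*γ^2*(γ-1)^2/((4*γ-3+p)*(p+1))) :
    ∃ c C m m₂ m₃ m₄ m₅ : ℝ, 0 < c ∧ 0 ≤ m ∧ ∀ X b d y τ K e Φ M N : ℝ,
      0 ≤ X → 0 ≤ τ → d ^ 2 ≤ X * τ → |K| ≤ τ → |e| ≤ |b| * τ → 0 ≤ N →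
      Φ ^ 2 ≤ N * X ^ 2 → |M| ≤ X * τ → 0 ≤ y → b ≤ - √(2 / (p + 1)) * y →
      c * (y ^ 2 + b ^ 2) ≤ C * τ ^ 2 -
        m * ((γ * b + γ * (γ - 1) * X + 2 * γ * d + K) ^ 2 - p * y ^ 2) +
        m₂ * (N - (γ * b + γ * (γ - 1) * X + 2 * γ * d + K) ^ 2) +
        m₃ * ((2 * γ - 1) * (2 * γ - 2) * (X * b) + (2 * γ - 1) * b ^ 2 +
          4 * (2 * γ - 1) * (b * d) + 2 * e + 2 * (b * K) - y ^ 2) +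
        m₄ * (-X ^ 2 + X * b - 2 * (X * d) + 2 / γ * (Φ - M)) +
        m₅ * (y * ((4 * γ - 3 + p) / 2 * X + b + 2 * d)) := by
  set ℓ := √(2 / (p + 1)) with hℓ
  set s := (4 * γ - 3 + p) / 2 with hs
  set G := γ ^ 2 * (γ - 1) ^ 2 with hG
  set κ := 1 - 4 * (γ - 1) ^ 2 with hκdef
  have hℓ0 : 0 ≤ ℓ := Real.sqrt_nonneg _
  have hℓ2 : ℓ ^ 2 = 2 / (p + 1) := Real.sq_sqrt (by positivity)
  have hs0 : 0 < s := by rw [hs]; linarith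
  have hG0 : 0 ≤ G := by positivity
  have hκ : 0 < κ := by
    have : (γ - 1) ^ 2 < (1 / 2) ^ 2 := pow_lt_pow_left₀ (by linarith) (by linarith) two_ne_zero
    rw [hκdef]; linarith
  have hγ0 : 0 < γ := by linarith
  have hEeq : p * κ - γ ^ 2 / (2 * γ - 1) + 8*γ^2*(γ-1)^2/((4*γ-3+p)*(p+1)) =
      p * κ - γ ^ 2 / (2 * γ - 1) + 2 * G * (ℓ ^ 2 / s) := by
    rw [hℓ2, hs, hG]
    have h1 : (4 * γ - 3 + p) ≠ 0 := by linarith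
    have h2 : p + 1 ≠ 0 := by linarith
    field_simp
    ring
  rw [hEeq] at hE
  obtain ⟨C₀, hC₀, hlap⟩ := laplacian_term_le hγ1.le
  obtain ⟨ε, hε, H⟩ := absorb_small_terms (p := p) (C₁ := 8 / γ ^ 2 + 1) (by linarith) hE hκ hC₀
    (by positivity)
  have hε₀ : 0 < ε / (1 + 4 * G) := by positivity
  set ε₀ := ε / (1 + 4 * G) with hε₀def
  obtain ⟨Ca, ha⟩ := bilaplacian_term_le hγ1.le hε₀
  obtain ⟨Cb, hb⟩ := gradient_term_le hγ1.le hε₀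
  have hε₁ : 0 < 1 / (4 * (1 + C₀)) := by positivity
  obtain ⟨Cc, hc⟩ := gradient_term_le hγ1.le hε₁
  obtain ⟨Cd, -, hd'⟩ := lower_order_young (show 0 < ε₀ / (2 * (ℓ / s) + 1) by positivity)
  set C := max (Ca + 2 * G * Cb + 2 * G * (2 * (ℓ / s) * Cd)) (4 * Cc + 1) with hC
  obtain ⟨c, C', m, a, hc0, hm, H⟩ := H C
  refine ⟨c, C', m, 4 * (γ - 1) ^ 2 + a * (8 / γ ^ 2), γ ^ 2 / (2 * γ - 1), -(2 * G) - a * 4,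
    - (2 * G * (ℓ / s)), hc0, hm, fun X b d y τ K e Φ M N hX hτ hd hK he hN hΦ hM hy hby => ?_⟩
  have ha' := ha X b d y τ K e hX hτ hd hK he
  have hb' := hb X b d y τ Φ M N hX hτ hd hN hΦ hM
  have hc' := hc X b d 0 τ Φ M N hX hτ hd hN hΦ hM
  have hl' := hlap X b d τ K hX hτ hd hK
  obtain ⟨-, -, -, hyd⟩ := hd' X b d y τ hX hτ hd
  set D₃ := (2 * γ - 1) * (2 * γ - 2) * (X * b) + (2 * γ - 1) * b ^ 2 +
          4 * (2 * γ - 1) * (b * d) + 2 * e + 2 * (b * K) - y ^ 2 with hD₃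
  set D₄ := -X ^ 2 + X * b - 2 * (X * d) + 2 / γ * (Φ - M) with hD₄
  set h := (γ * b + γ * (γ - 1) * X + 2 * γ * d + K) ^ 2 with hh
  have hτ2 := sq_nonneg τ
  have hCa : (Ca + 2 * G * Cb + 2 * G * (2 * (ℓ / s) * Cd)) * τ ^ 2 ≤ C * τ ^ 2 :=
    mul_le_mul_of_nonneg_right (le_max_left _ _) hτ2
  have hCb : (4 * Cc + 1) * τ ^ 2 ≤ C * τ ^ 2 :=
    mul_le_mul_of_nonneg_right (le_max_right _ _) hτ2
  set S := X ^ 2 + b ^ 2 + y ^ 2 with hS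
  have hS0 : 0 ≤ S := by positivity
  have hb0 : b ≤ 0 := hby.trans (by
    rw [neg_mul]
    exact neg_nonpos.2 (mul_nonneg hℓ0 hy))
  have hXb0 : X * b ≤ 0 := mul_nonpos_of_nonneg_of_nonpos hX hb0
  have hXb : X * b ≤ - ((ℓ / s) * (y * (s * X + b + 2 * d))) - ℓ ^ 2 / s * y ^ 2 +
      2 * (ℓ / s) * (y * d) := by
    have h1 : X * b ≤ - (ℓ * (y * X)) :=
      (mul_le_mul_of_nonneg_left hby hX).trans (le_of_eq (by ring))
    have h2 : ℓ / s * (ℓ * y * y) ≤ ℓ / s * (- b * y) :=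
      mul_le_mul_of_nonneg_left (mul_le_mul_of_nonneg_right (by linarith) hy) (by positivity)
    have h3 : (ℓ / s) * (y * (s * X + b + 2 * d)) =
        ℓ * (y * X) - ℓ / s * (- b * y) + 2 * (ℓ / s) * (y * d) := by
      field_simp; ring
    have h4 : ℓ ^ 2 / s * y ^ 2 = ℓ / s * (ℓ * y * y) := by ring
    linarith
  have hyd2 : 2 * (ℓ / s) * (y * d) ≤ ε₀ * S + 2 * (ℓ / s) * Cd * τ ^ 2 := by
    have h0 : 0 ≤ 2 * (ℓ / s) := by positivity
    have h1 : 2 * (ℓ / s) * (y * d) ≤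
        2 * (ℓ / s) * (ε₀ / (2 * (ℓ / s) + 1) * S + Cd * τ ^ 2) :=
      mul_le_mul_of_nonneg_left ((le_abs_self _).trans hyd) h0
    have h2 : 2 * (ℓ / s) * (ε₀ / (2 * (ℓ / s) + 1)) ≤ ε₀ := by
      rw [mul_div_assoc', div_le_iff₀ (by positivity)]
      linarith
    have h3 := mul_le_mul_of_nonneg_right h2 hS0
    linarith
  have hXX : 2 * G * (X ^ 2 / 2) ≤ 2 * G * (- D₄ - (ℓ / s) * (y * (s * X + b + 2 * d)) -
      ℓ ^ 2 / s * y ^ 2 + 2 / γ ^ 2 * N + 2 * (ε₀ * S) +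
      (Cb * τ ^ 2 + 2 * (ℓ / s) * Cd * τ ^ 2)) :=
    mul_le_mul_of_nonneg_left (by linarith) (by positivity)
  have hGγ : 2 * G * (2 / γ ^ 2 * N) = 4 * (γ - 1) ^ 2 * N := by
    rw [hG]; field_simp; ring
  have hεS : (1 + 4 * G) * (ε₀ * S) = ε * S := by
    rw [hε₀def]; field_simp
  have hX2 := sq_nonneg X
  have hε₁C : 1 / (4 * (1 + C₀)) * (X ^ 2 + b ^ 2 + 0 ^ 2) ≤
      1 / 4 * (X ^ 2 + h + τ ^ 2) := by
    have h1 : X ^ 2 + b ^ 2 + 0 ^ 2 ≤ (1 + C₀) * (X ^ 2 + h + τ ^ 2) := by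
      have : 0 ≤ h := sq_nonneg _
      linarith
    calc _ ≤ 1 / (4 * (1 + C₀)) * ((1 + C₀) * (X ^ 2 + h + τ ^ 2)) :=
          mul_le_mul_of_nonneg_left h1 hε₁.le
      _ = _ := by field_simp
  have H' := H X b y τ h
    (γ ^ 2 / (2 * γ - 1) * D₃ - 2 * G * D₄ - 2 * G * (ℓ / s) * (y * (s * X + b + 2 * d)) +
      4 * (γ - 1) ^ 2 * (N - h))
    (- (4 * D₄) + 8 / γ ^ 2 * (N - h)) ?_ ?_ ?_
  · linarith
  · rw [← hS, hκdef]
    linarith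
  · have e1 : 8 / γ ^ 2 * (N - h) = 4 * (2 / γ ^ 2 * N) - 8 / γ ^ 2 * h := by ring
    have e2 : (8 / γ ^ 2 + 1) * h = 8 / γ ^ 2 * h + h := by ring
    rw [e1, e2]
    linarith
  · linarith

end PointwiseAlgebra

/-! ### Integral identities -/

section IntegralIdentities

variable {n : ℕ} {f g h L φ : EuclideanSpace ℝ (Fin n) → ℝ} {x : EuclideanSpace ℝ (Fin n)}

/-- The pointwise inner product of two gradients. -/
noncomputable def dotGrad (f g : EuclideanSpace ℝ (Fin n) → ℝ)
    (x : EuclideanSpace ℝ (Fin n)) : ℝ :=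
  ∑ i, pd i f x * pd i g x

/-- The Hessian of `f` evaluated at the gradient of `g`. -/
noncomputable def hessQuad (f g : EuclideanSpace ℝ (Fin n) → ℝ)
    (x : EuclideanSpace ℝ (Fin n)) : ℝ :=
  ∑ i, ∑ j, pd i (pd j f) x * pd i g x * pd j g x

/-- The Hessian of `exp (c * L) * g` divided by `exp (c * L)`. -/
noncomputable def twistedHess (c : ℝ) (L g : EuclideanSpace ℝ (Fin n) → ℝ) (i j : Fin n)
    (x : EuclideanSpace ℝ (Fin n)) : ℝ :=
  c ^ 2 * (pd i L x * pd j L x * g x) + c * (pd i L x * pd j g x) + c * (pd j L x * pd i g x) +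
    c * (pd i (pd j L) x * g x) + pd i (pd j g) x

lemma ContDiff.dotGrad {k m : WithTop ℕ∞} (hf : ContDiff ℝ m f) (hg : ContDiff ℝ m g)
    (hk : k + 1 ≤ m) : ContDiff ℝ k (dotGrad f g) :=
  ContDiff.sum fun i _ => (hf.pd hk i).mul (hg.pd hk i)

lemma differentiable_pd (hf : ContDiff ℝ 2 f) (i : Fin n) : Differentiable ℝ (pd i f) :=
  (hf.pd (k := 1) (by norm_num) i).differentiable (by norm_num)

lemma ContDiff.exp_mul {m : WithTop ℕ∞} (hL : ContDiff ℝ m L) (hg : ContDiff ℝ m g) (c : ℝ) :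
    ContDiff ℝ m (fun y => Real.exp (c * L y) * g y) :=
  ((contDiff_const.mul hL).exp).mul hg

lemma pd_pd_exp_mul (c : ℝ) (hL : ContDiff ℝ 2 L) (hg : ContDiff ℝ 2 g) (i j : Fin n) :
    pd i (pd j (fun y => exp (c * L y) * g y)) x = exp (c * L x) * twistedHess c L g i j x := by
  have dL : Differentiable ℝ L := hL.differentiable (by norm_num)
  have dg : Differentiable ℝ g := hg.differentiable (by norm_num)
  have dLj := differentiable_pd hL j
  have dgj := differentiable_pd hg j
  have e1 : pd j (fun y => exp (c * L y) * g y) =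
      fun y => exp (c * L y) * (c * (pd j L y * g y) + pd j g y) := by
    funext y
    rw [pd_exp_mul c (dL y) (dg y)]; ring
  have d1 : Differentiable ℝ (fun y => pd j L y * g y) := dLj.fun_mul dg
  rw [e1, pd_exp_mul c (dL x) (((d1 x).const_mul c).fun_add (dgj x)),
    pd_add ((d1 x).const_mul c) (dgj x), pd_const_mul c (d1 x), pd_mul (dLj x) (dg x), twistedHess]
  ring

lemma sum_twistedHess (c : ℝ) (hL : ContDiff ℝ 2 L) (hg : ContDiff ℝ 2 g) :
    ∑ i, twistedHess c L g i i x =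
      c ^ 2 * (dotGrad L L x * g x) + 2 * c * dotGrad L g x + c * (lap L x * g x) + lap g x := by
  simp only [lap_eq_sum_pd hL, lap_eq_sum_pd hg, dotGrad, twistedHess, Finset.sum_mul,
    Finset.mul_sum, ← Finset.sum_add_distrib]
  exact Finset.sum_congr rfl fun i _ => by ring

lemma lap_exp_mul (c : ℝ) (hL : ContDiff ℝ 2 L) (hg : ContDiff ℝ 2 g) :
    lap (fun y => exp (c * L y) * g y) x = exp (c * L x) *
      (c ^ 2 * (dotGrad L L x * g x) + 2 * c * dotGrad L g x + c * (lap L x * g x) + lap g x) := by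
  rw [lap_eq_sum_pd (hL.exp_mul hg c), ← sum_twistedHess c hL hg, Finset.mul_sum]
  exact Finset.sum_congr rfl fun i _ => pd_pd_exp_mul c hL hg i i

lemma dotGrad_mul_left (hf : DifferentiableAt ℝ f x) (hg : DifferentiableAt ℝ g x) :
    dotGrad (fun y => f y * g y) h x = f x * dotGrad g h x + g x * dotGrad f h x := by
  simp only [dotGrad, pd_mul hf hg, Finset.mul_sum, ← Finset.sum_add_distrib]
  exact Finset.sum_congr rfl fun i _ => by ring

lemma dotGrad_comm : dotGrad f g x = dotGrad g f x :=
  Finset.sum_congr rfl fun _ _ => mul_comm _ _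

lemma lap_mul (hf : ContDiff ℝ 2 f) (hg : ContDiff ℝ 2 g) :
    lap (fun y => f y * g y) x = f x * lap g x + 2 * dotGrad f g x + g x * lap f x := by
  have df : Differentiable ℝ f := hf.differentiable (by norm_num)
  have dg : Differentiable ℝ g := hg.differentiable (by norm_num)
  rw [lap_eq_sum_pd (hf.mul hg), lap_eq_sum_pd hf, lap_eq_sum_pd hg]
  simp only [dotGrad, Finset.mul_sum, ← Finset.sum_add_distrib]
  refine Finset.sum_congr rfl fun i _ => ?_
  have e1 : pd i (fun y => f y * g y) = fun y => f y * pd i g y + g y * pd i f y := by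
    funext y; exact pd_mul (df y) (dg y)
  have dfi := differentiable_pd hf i
  have dgi := differentiable_pd hg i
  rw [e1, pd_add ((df x).fun_mul (dgi x)) ((dg x).fun_mul (dfi x)), pd_mul (df x) (dgi x),
    pd_mul (dg x) (dfi x)]
  ring

lemma lap_const_mul (hf : ContDiff ℝ 2 f) (c : ℝ) : lap (fun y => c * f y) x = c * lap f x := by
  have df : Differentiable ℝ f := hf.differentiable (by norm_num)
  rw [lap_eq_sum_pd (contDiff_const.mul hf), lap_eq_sum_pd hf]
  simp only [Finset.mul_sum]
  refine Finset.sum_congr rfl fun i _ => ?_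
  have e1 : pd i (fun y => c * f y) = fun y => c * pd i f y := by
    funext y; exact pd_const_mul c (df y)
  rw [e1, pd_const_mul c (differentiable_pd hf i x)]

lemma dotGrad_dotGrad_self (hL : ContDiff ℝ 2 L) :
    dotGrad (dotGrad L L) L x = 2 * hessQuad L L x := by
  have h1 : ∀ i, pd i (dotGrad L L) x = ∑ j, 2 * (pd i (pd j L) x * pd j L x) := by
    intro i
    have e : dotGrad L L = fun y => ∑ j, pd j L y * pd j L y := rfl
    rw [e, pd_sum _ fun j _ => (differentiable_pd hL j x).fun_mul (differentiable_pd hL j x)]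
    refine Finset.sum_congr rfl fun j _ => ?_
    rw [pd_mul (differentiable_pd hL j x) (differentiable_pd hL j x)]; ring
  rw [dotGrad, hessQuad]
  simp only [h1, Finset.sum_mul, Finset.mul_sum]
  exact Finset.sum_congr rfl fun i _ => Finset.sum_congr rfl fun j _ => by ring

lemma integral_div_exp_mul_grad (c : ℝ) (hL : ContDiff ℝ 2 L) (hh : ContDiff ℝ 1 h)
    (hc : HasCompactSupport h) :
    ∫ x, exp (c * L x) * (c * (dotGrad L L x * h x) + dotGrad h L x + h x * lap L x) = 0 := by
  have hLi : ∀ i, ContDiff ℝ 1 (pd i L) := fun i => hL.pd (by norm_num) i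
  have dL : Differentiable ℝ L := hL.differentiable (by norm_num)
  have dh : Differentiable ℝ h := hh.differentiable (by norm_num)
  have hL1 : ContDiff ℝ 1 L := hL.of_le (by norm_num)
  rw [← integral_sum_pd_eq_zero (X := fun i y => exp (c * L y) * (h y * pd i L y))
    (fun i => hL1.exp_mul (hh.mul (hLi i)) c) (fun i => (hc.mul_right).mul_left)]
  congr 1
  funext x
  rw [lap_eq_sum_pd hL]
  have h1 : ∀ i, pd i (fun y => exp (c * L y) * (h y * pd i L y)) x = exp (c * L x) *
      (c * (pd i L x * pd i L x * h x) + pd i h x * pd i L x + h x * pd i (pd i L) x) := by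
    intro i
    have dLi := differentiable_pd hL i x
    rw [pd_exp_mul c (dL x) ((dh x).fun_mul dLi), pd_mul (dh x) dLi]; ring
  simp only [h1, dotGrad, Finset.mul_sum, Finset.sum_mul, ← Finset.sum_add_distrib]

end IntegralIdentities

section WeightedIdentities

variable {n : ℕ} {L φ : EuclideanSpace ℝ (Fin n) → ℝ} {x : EuclideanSpace ℝ (Fin n)} {p γ : ℝ}

lemma lap_exp (hL : ContDiff ℝ 2 L) :
    lap (fun y => exp (L y)) x = exp (L x) * (lap L x + dotGrad L L x) := by
  have h := lap_exp_mul (x := x) 1 hL (contDiff_const (c := (1 : ℝ)))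
  have h1 : lap (fun _ : EuclideanSpace ℝ (Fin n) => (1 : ℝ)) x = 0 := by
    rw [lap_eq_sum_pd contDiff_const]
    have (i : Fin n) : pd i (fun _ : EuclideanSpace ℝ (Fin n) => (1 : ℝ)) = fun _ => 0 := by
      funext y; simp [pd]
    simp only [this]
    simp [pd]
  have h2 : dotGrad L (fun _ : EuclideanSpace ℝ (Fin n) => (1 : ℝ)) x = 0 := by
    simp [dotGrad, pd]
  simp only [h1, h2, one_mul, mul_one] at h
  rw [h]; ring

lemma integral_weighted_lap_sq (hL : ContDiff ℝ 3 L) (hφ : ContDiff ℝ 3 φ)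
    (hc : HasCompactSupport φ) :
    ∫ x, exp (2 * γ * L x) * (∑ i, ∑ j, twistedHess γ L φ i j x ^ 2 -
      (γ * ((lap L x + dotGrad L L x) * φ x) + γ * (γ - 1) * (dotGrad L L x * φ x) +
        2 * γ * dotGrad L φ x + lap φ x) ^ 2) = 0 := by
  have hf := hL.exp_mul hφ γ
  have hfc : HasCompactSupport (fun y => exp (γ * L y) * φ y) := hc.mul_left
  have hL2 : ContDiff ℝ 2 L := hL.of_le (by norm_num)
  have hφ2 : ContDiff ℝ 2 φ := hφ.of_le (by norm_num)
  have h := integral_lap_sq hf hfc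
  have i1 : Integrable (fun x => (lap (fun y => exp (γ * L y) * φ y) x) ^ 2) :=
    ((hf.lap (k := 0) (by norm_num)).continuous.pow 2).integrable_of_hasCompactSupport
      (by simpa [pow_two] using hfc.lap.mul_right)
  have i2 : Integrable (fun x => ∑ i, ∑ j, (pd i (pd j (fun y => exp (γ * L y) * φ y)) x) ^ 2) := by
    refine integrable_finsetSum _ fun i _ => integrable_finsetSum _ fun j _ => ?_
    refine ((((hf.pd (k := 1) (by norm_num) j).pd (k := 0) (by norm_num) i)).continuous.pow
      2).integrable_of_hasCompactSupport ?_
    simpa [pow_two] using ((hfc.pd j).pd i).mul_right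
  rw [← sub_eq_zero, ← integral_sub i1 i2, ← neg_eq_zero, ← integral_neg] at h
  rw [← h]
  congr 1
  funext x
  rw [lap_exp_mul γ hL2 hφ2]
  simp only [pd_pd_exp_mul γ hL2 hφ2]
  have e : exp (2 * γ * L x) = exp (γ * L x) ^ 2 := by rw [pow_two, ← exp_add]; ring_nf
  simp only [e, mul_pow, ← Finset.mul_sum]
  ring

lemma integral_weighted_stability (hL : ContDiff ℝ 3 L)
    (hstab : ∀ φ : EuclideanSpace ℝ (Fin n) → ℝ, ContDiff ℝ (⊤ : ℕ∞) φ → HasCompactSupport φ →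
      ∫ x, p * exp ((p - 1) * L x) * φ x ^ 2 ≤ ∫ x, (lap φ x) ^ 2)
    (hφ : ContDiff ℝ 3 φ) (hc : HasCompactSupport φ) :
    0 ≤ ∫ x, exp (2 * γ * L x) *
      ((γ * ((lap L x + dotGrad L L x) * φ x) + γ * (γ - 1) * (dotGrad L L x * φ x) +
        2 * γ * dotGrad L φ x + lap φ x) ^ 2 - p * (exp ((p - 1) / 2 * L x) * φ x) ^ 2) := by
  have hf := hL.exp_mul hφ γ
  have hfc : HasCompactSupport (fun y => exp (γ * L y) * φ y) := hc.mul_left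
  have hL2 : ContDiff ℝ 2 L := hL.of_le (by norm_num)
  have hφ2 : ContDiff ℝ 2 φ := hφ.of_le (by norm_num)
  have hV : Continuous (fun x => p * exp ((p - 1) * L x)) :=
    continuous_const.mul (continuous_const.mul hL.continuous).rexp
  have h := stable_of_smooth hV hstab (hf.of_le (by norm_num)) hfc
  have i1 : Integrable (fun x => (lap (fun y => exp (γ * L y) * φ y) x) ^ 2) :=
    ((hf.lap (k := 0) (by norm_num)).continuous.pow 2).integrable_of_hasCompactSupport
      (by simpa [pow_two] using hfc.lap.mul_right)
  have i2 : Integrable (fun x => p * exp ((p - 1) * L x) * (exp (γ * L x) * φ x) ^ 2) :=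
    (hV.mul (hf.continuous.pow 2)).integrable_of_hasCompactSupport
      (HasCompactSupport.mul_left (by simpa only [pow_two] using hfc.mul_right))
  rw [← sub_nonneg, ← integral_sub i1 i2] at h
  refine h.trans (le_of_eq ?_)
  congr 1
  funext x
  rw [lap_exp_mul γ hL2 hφ2]
  have e : exp (2 * γ * L x) = exp (γ * L x) ^ 2 := by rw [pow_two, ← exp_add]; ring_nf
  have e2 : exp ((p - 1) * L x) = exp ((p - 1) / 2 * L x) ^ 2 := by
    rw [pow_two, ← exp_add]; ring_nf
  rw [e, e2]
  ring

lemma integral_weighted_equation (hL : ContDiff ℝ 4 L)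
    (heq : ∀ x, lap (lap (fun y => exp (L y))) x = exp (p * L x))
    (hφ : ContDiff ℝ 3 φ) (hc : HasCompactSupport φ) :
    ∫ x, exp (2 * γ * L x) *
      ((2 * γ - 1) * (2 * γ - 2) * ((dotGrad L L x * φ x) * ((lap L x + dotGrad L L x) * φ x)) +
        (2 * γ - 1) * ((lap L x + dotGrad L L x) * φ x) ^ 2 +
        4 * (2 * γ - 1) * (((lap L x + dotGrad L L x) * φ x) * dotGrad L φ x) +
        2 * ((lap L x + dotGrad L L x) * dotGrad φ φ x) +
        2 * (((lap L x + dotGrad L L x) * φ x) * lap φ x) -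
        (exp ((p - 1) / 2 * L x) * φ x) ^ 2) = 0 := by
  have hL2 : ContDiff ℝ 2 L := hL.of_le (by norm_num)
  have hφ2 : ContDiff ℝ 2 φ := hφ.of_le (by norm_num)
  have hψ := hL2.exp_mul (hφ2.mul hφ2) (2 * γ - 1)
  have hψc : HasCompactSupport (fun y => exp ((2 * γ - 1) * L y) * (φ y * φ y)) :=
    hc.mul_left.mul_left
  have hu : ContDiff ℝ 4 (fun y => exp (L y)) := hL.exp
  have hΔ : ContDiff ℝ 2 (lap (fun y => exp (L y))) := hu.lap (by norm_num)
  have h := integral_mul_lap hψ hΔ hψc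
  have i1 : Integrable (fun x => exp ((2 * γ - 1) * L x) * (φ x * φ x) *
      lap (lap (fun y => exp (L y))) x) :=
    (hψ.continuous.mul (hΔ.lap (k := 0) (by norm_num)).continuous).integrable_of_hasCompactSupport
      hψc.mul_right
  have i2 : Integrable (fun x => lap (fun y => exp ((2 * γ - 1) * L y) * (φ y * φ y)) x *
      lap (fun y => exp (L y)) x) :=
    ((hψ.lap (k := 0) (by norm_num)).continuous.mul hΔ.continuous).integrable_of_hasCompactSupport
      hψc.lap.mul_right
  rw [eq_comm, ← sub_eq_zero, ← integral_sub i2 i1] at h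
  rw [← h]
  congr 1
  funext x
  have dφ := (hφ2.differentiable (by norm_num)) x
  rw [heq, lap_exp_mul _ hL2 (hφ2.mul hφ2), lap_mul hφ2 hφ2, lap_exp hL2,
    dotGrad_comm (f := L) (g := fun y => φ y * φ y), dotGrad_mul_left dφ dφ,
    dotGrad_comm (f := φ) (g := L)]
  have e : exp (2 * γ * L x) = exp ((2 * γ - 1) * L x) * exp (L x) := by
    rw [← exp_add]; ring_nf
  have e2 : exp (p * L x) = exp (L x) * exp ((p - 1) / 2 * L x) ^ 2 := by
    rw [pow_two, ← exp_add, ← exp_add]; ring_nf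
  rw [e, e2]
  ring

lemma sum_twistedHess_mul_grad :
    ∑ i, ∑ j, twistedHess γ L φ i j x * (pd i L x * pd j L x) =
      γ ^ 2 * (dotGrad L L x ^ 2 * φ x) + 2 * γ * (dotGrad L L x * dotGrad L φ x) +
        γ * (hessQuad L L x * φ x) + hessQuad φ L x := by
  have e1 : dotGrad L L x ^ 2 = ∑ i, ∑ j, (pd i L x * pd i L x) * (pd j L x * pd j L x) := by
    rw [pow_two, dotGrad, Finset.sum_mul_sum]
  have e2 : dotGrad L L x * dotGrad L φ x =
      ∑ i, ∑ j, (pd i L x * pd i L x) * (pd j L x * pd j φ x) := by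
    rw [dotGrad, dotGrad, Finset.sum_mul_sum]
  have e3 : dotGrad L L x * dotGrad L φ x =
      ∑ i, ∑ j, (pd i L x * pd i φ x) * (pd j L x * pd j L x) := by
    rw [mul_comm, dotGrad, dotGrad, Finset.sum_mul_sum]
  rw [two_mul γ, add_mul γ γ]
  nth_rw 2 [e3]
  rw [e1, e2, hessQuad, hessQuad]
  simp only [twistedHess, Finset.mul_sum, Finset.sum_mul, ← Finset.sum_add_distrib]
  exact Finset.sum_congr rfl fun i _ => Finset.sum_congr rfl fun j _ => by ring

lemma integral_weighted_gradient (hγ : γ ≠ 0) (hL : ContDiff ℝ 3 L) (hφ : ContDiff ℝ 3 φ)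
    (hc : HasCompactSupport φ) :
    ∫ x, exp (2 * γ * L x) * (- (dotGrad L L x * φ x) ^ 2 +
      (dotGrad L L x * φ x) * ((lap L x + dotGrad L L x) * φ x) -
      2 * ((dotGrad L L x * φ x) * dotGrad L φ x) +
      2 / γ * (φ x * ∑ i, ∑ j, twistedHess γ L φ i j x * (pd i L x * pd j L x) -
        φ x * hessQuad φ L x)) = 0 := by
  have hL2 : ContDiff ℝ 2 L := hL.of_le (by norm_num)
  have hφ2 : ContDiff ℝ 2 φ := hφ.of_le (by norm_num)
  have hφ1 : ContDiff ℝ 1 φ := hφ.of_le (by norm_num)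
  have hA : ContDiff ℝ 1 (dotGrad L L) := hL2.dotGrad hL2 (by norm_num)
  rw [← integral_div_exp_mul_grad (2 * γ) hL2 (hA.mul (hφ1.mul hφ1)) (hc.mul_left.mul_left)]
  congr 1
  funext x
  have dφ := (hφ1.differentiable (by norm_num)) x
  have dA := (hA.differentiable (by norm_num)) x
  rw [dotGrad_mul_left dA (dφ.fun_mul dφ), dotGrad_mul_left dφ dφ, dotGrad_dotGrad_self hL2,
    sum_twistedHess_mul_grad, dotGrad_comm (f := φ) (g := L)]
  field_simp
  ring

lemma integral_weighted_power (hL : ContDiff ℝ 3 L) (hφ : ContDiff ℝ 3 φ)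
    (hc : HasCompactSupport φ) :
    ∫ x, exp (2 * γ * L x) * ((exp ((p - 1) / 2 * L x) * φ x) *
      ((4 * γ - 3 + p) / 2 * (dotGrad L L x * φ x) + (lap L x + dotGrad L L x) * φ x +
        2 * dotGrad L φ x)) = 0 := by
  have hL2 : ContDiff ℝ 2 L := hL.of_le (by norm_num)
  have hφ1 : ContDiff ℝ 1 φ := hφ.of_le (by norm_num)
  rw [← integral_div_exp_mul_grad (2 * γ + (p - 1) / 2) hL2 (hφ1.mul hφ1) hc.mul_left]
  congr 1
  funext x
  have dφ := (hφ1.differentiable (by norm_num)) x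
  rw [dotGrad_mul_left dφ dφ, dotGrad_comm (f := φ) (g := L),
    add_mul (2 * γ) ((p - 1) / 2) (L x), exp_add]
  ring

end WeightedIdentities

section IntegralEstimate

variable {n : ℕ} {L φ τ : EuclideanSpace ℝ (Fin n) → ℝ} {p γ : ℝ}

/-- The pointwise inequality behind the integral estimate, under the extra sign information `R`
on the pair `(b, y)`. -/
def CoreEstimate (p γ : ℝ) (R : ℝ → ℝ → Prop) : Prop :=
  ∃ c C m m₂ m₃ m₄ m₅ : ℝ, 0 < c ∧ 0 ≤ m ∧ ∀ X b d y τ K e Φ M N : ℝ,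
    0 ≤ X → 0 ≤ τ → d ^ 2 ≤ X * τ → |K| ≤ τ → |e| ≤ |b| * τ → 0 ≤ N → Φ ^ 2 ≤ N * X ^ 2 →
    |M| ≤ X * τ → 0 ≤ y → R b y →
    c * (y ^ 2 + b ^ 2) ≤ C * τ ^ 2 -
      m * ((γ * b + γ * (γ - 1) * X + 2 * γ * d + K) ^ 2 - p * y ^ 2) +
      m₂ * (N - (γ * b + γ * (γ - 1) * X + 2 * γ * d + K) ^ 2) +
      m₃ * ((2 * γ - 1) * (2 * γ - 2) * (X * b) + (2 * γ - 1) * b ^ 2 +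
        4 * (2 * γ - 1) * (b * d) + 2 * e + 2 * (b * K) - y ^ 2) +
      m₄ * (- X ^ 2 + X * b - 2 * (X * d) + 2 / γ * (Φ - M)) +
      m₅ * (y * ((4 * γ - 3 + p) / 2 * X + b + 2 * d))

lemma sq_sum_sum_mul_le (F : Fin n → Fin n → ℝ) (a : Fin n → ℝ) :
    (∑ i, ∑ j, F i j * (a i * a j)) ^ 2 ≤ (∑ i, ∑ j, F i j ^ 2) * (∑ i, a i * a i) ^ 2 := by
  have h := Finset.sum_mul_sq_le_sq_mul_sq (Finset.univ : Finset (Fin n × Fin n))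
    (fun q => F q.1 q.2) (fun q => a q.1 * a q.2)
  rw [Fintype.sum_prod_type, Fintype.sum_prod_type, Fintype.sum_prod_type] at h
  refine h.trans (le_of_eq ?_)
  congr 1
  rw [pow_two, Finset.sum_mul_sum]
  exact Finset.sum_congr rfl fun i _ => Finset.sum_congr rfl fun j _ => by ring

lemma dotGrad_self_nonneg (x : EuclideanSpace ℝ (Fin n)) : 0 ≤ dotGrad L L x :=
  Finset.sum_nonneg fun _ _ => mul_self_nonneg _

lemma sq_dotGrad_le (x : EuclideanSpace ℝ (Fin n)) :
    dotGrad L φ x ^ 2 ≤ dotGrad L L x * dotGrad φ φ x := by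
  simpa only [dotGrad, pow_two] using
    Finset.sum_mul_sq_le_sq_mul_sq Finset.univ (fun i => pd i L x) (fun i => pd i φ x)

lemma integral_le_of_linear_combination {E : Type*} [MeasurableSpace E] {μ : Measure E}
    {f₀ g f₁ f₂ f₃ f₄ f₅ : E → ℝ} {c C m m₂ m₃ m₄ m₅ : ℝ} (hc : 0 < c) (hm : 0 ≤ m)
    (i₀ : Integrable f₀ μ) (ig : Integrable g μ) (i₁ : Integrable f₁ μ) (i₂ : Integrable f₂ μ)
    (i₃ : Integrable f₃ μ) (i₄ : Integrable f₄ μ) (i₅ : Integrable f₅ μ)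
    (h₁ : 0 ≤ ∫ x, f₁ x ∂μ) (h₂ : ∫ x, f₂ x ∂μ = 0) (h₃ : ∫ x, f₃ x ∂μ = 0)
    (h₄ : ∫ x, f₄ x ∂μ = 0) (h₅ : ∫ x, f₅ x ∂μ = 0)
    (h : ∀ x, c * f₀ x ≤
      C * g x - m * f₁ x + m₂ * f₂ x + m₃ * f₃ x + m₄ * f₄ x + m₅ * f₅ x) :
    ∫ x, f₀ x ∂μ ≤ C / c * ∫ x, g x ∂μ := by
  have j₁ : Integrable (fun x => C * g x - m * f₁ x) μ := (ig.const_mul C).sub (i₁.const_mul m)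
  have j₂ : Integrable (fun x => C * g x - m * f₁ x + m₂ * f₂ x) μ := j₁.add (i₂.const_mul m₂)
  have j₃ : Integrable (fun x => C * g x - m * f₁ x + m₂ * f₂ x + m₃ * f₃ x) μ :=
    j₂.add (i₃.const_mul m₃)
  have j₄ : Integrable (fun x => C * g x - m * f₁ x + m₂ * f₂ x + m₃ * f₃ x + m₄ * f₄ x) μ :=
    j₃.add (i₄.const_mul m₄)
  have key := integral_mono (i₀.const_mul c) (j₄.add (i₅.const_mul m₅)) h
  simp only [Pi.add_apply] at key
  rw [integral_add j₄ (i₅.const_mul m₅), integral_add j₃ (i₄.const_mul m₄),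
    integral_add j₂ (i₃.const_mul m₃), integral_add j₁ (i₂.const_mul m₂),
    integral_sub (ig.const_mul C) (i₁.const_mul m)] at key
  simp only [integral_const_mul, h₂, h₃, h₄, h₅, mul_zero, add_zero] at key
  have := mul_nonneg hm h₁
  rw [div_mul_eq_mul_div, le_div_iff₀ hc, mul_comm]
  linarith

lemma CoreEstimate.integral_le {R : ℝ → ℝ → Prop} (hcore : CoreEstimate p γ R) (hγ : γ ≠ 0) :
    ∃ C, 0 ≤ C ∧ ∀ L φ τ : EuclideanSpace ℝ (Fin n) → ℝ, ContDiff ℝ 4 L →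
      (∀ x, lap (lap (fun y => Real.exp (L y))) x = Real.exp (p * L x)) →
      (∀ φ : EuclideanSpace ℝ (Fin n) → ℝ, ContDiff ℝ (⊤ : ℕ∞) φ → HasCompactSupport φ →
        ∫ x, p * Real.exp ((p - 1) * L x) * φ x ^ 2 ≤ ∫ x, (lap φ x) ^ 2) →
      ContDiff ℝ 3 φ → HasCompactSupport φ → (∀ x, 0 ≤ φ x) →
      Continuous τ → HasCompactSupport τ → (∀ x, 0 ≤ τ x) →
      (∀ x, dotGrad φ φ x ≤ φ x * τ x) → (∀ x, |lap φ x| ≤ τ x) →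
      (∀ x, ∑ i, ∑ j, pd i (pd j φ) x ^ 2 ≤ τ x ^ 2) →
      (∀ x, R ((lap L x + dotGrad L L x) * φ x) (Real.exp ((p - 1) / 2 * L x) * φ x)) →
      ∫ x, Real.exp (2 * γ * L x) * ((Real.exp ((p - 1) / 2 * L x) * φ x) ^ 2 +
        ((lap L x + dotGrad L L x) * φ x) ^ 2) ≤ C * ∫ x, Real.exp (2 * γ * L x) * τ x ^ 2 := by
  obtain ⟨c, C, m, m₂, m₃, m₄, m₅, hc, hm, H⟩ := hcore
  refine ⟨max C 0 / c, by positivity, ?_⟩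
  intro L φ τ hL heq hstab hφ hφc hφ0 hτ hτc hτ0 hG hK hN hR
  have hL3 : ContDiff ℝ 3 L := hL.of_le (by norm_num)
  have hL2 : ContDiff ℝ 2 L := hL.of_le (by norm_num)
  have hφ2 : ContDiff ℝ 2 φ := hφ.of_le (by norm_num)
  have J1 := integral_weighted_stability (γ := γ) hL3 hstab hφ hφc
  have J2 := integral_weighted_lap_sq (γ := γ) hL3 hφ hφc
  have J3 := integral_weighted_equation (γ := γ) hL heq hφ hφc
  have J4 := integral_weighted_gradient hγ hL3 hφ hφc
  have J5 := integral_weighted_power (p := p) (γ := γ) hL3 hφ hφc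
  have z0 : ∀ x ∉ tsupport φ, φ x = 0 := fun x hx => image_eq_zero_of_notMem_tsupport hx
  have z1 : ∀ i, ∀ x ∉ tsupport φ, pd i φ x = 0 := fun i x hx => by
    simp [pd, fderiv_of_notMem_tsupport (𝕜 := ℝ) hx]
  have z2 : ∀ i j, ∀ x ∉ tsupport φ, pd i (pd j φ) x = 0 := fun i j x hx => by
    have : x ∉ tsupport (pd j φ) := fun h => hx (closure_minimal (fun y hy => by
      by_contra hy'
      exact hy (z1 j y hy')) (isClosed_tsupport φ) h)
    simp [pd, fderiv_of_notMem_tsupport (𝕜 := ℝ) this]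
  have zd : ∀ x ∉ tsupport φ, dotGrad L φ x = 0 := fun x hx => by simp [dotGrad, z1 _ x hx]
  have zG : ∀ x ∉ tsupport φ, dotGrad φ φ x = 0 := fun x hx => by simp [dotGrad, z1 _ x hx]
  have zK : ∀ x ∉ tsupport φ, lap φ x = 0 := fun x hx => by
    simp [lap_eq_sum_pd hφ2, z2 _ _ x hx]
  have zN : ∀ i j, ∀ x ∉ tsupport φ, twistedHess γ L φ i j x = 0 := fun i j x hx => by
    simp [twistedHess, z0 x hx, z1 _ x hx, z2 _ _ x hx]
  have cL := hL.continuous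
  have cφ := hφ.continuous
  have cA : Continuous (dotGrad L L) := (hL3.dotGrad (k := 2) hL3 (by norm_num)).continuous
  have cd : Continuous (dotGrad L φ) := (hL3.dotGrad (k := 2) hφ (by norm_num)).continuous
  have cG : Continuous (dotGrad φ φ) := (hφ.dotGrad (k := 2) hφ (by norm_num)).continuous
  have cS : Continuous (lap L) := (hL3.lap (k := 1) (by norm_num)).continuous
  have cK : Continuous (lap φ) := (hφ.lap (k := 1) (by norm_num)).continuous
  have cL1 : ∀ i, Continuous (pd i L) := fun i => (hL3.pd (k := 2) (by norm_num) i).continuous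
  have cφ1 : ∀ i, Continuous (pd i φ) := fun i => (hφ.pd (k := 2) (by norm_num) i).continuous
  have cL2 : ∀ i j, Continuous (pd i (pd j L)) := fun i j =>
    ((hL3.pd (k := 2) (by norm_num) j).pd (k := 1) (by norm_num) i).continuous
  have cφ2 : ∀ i j, Continuous (pd i (pd j φ)) := fun i j =>
    ((hφ.pd (k := 2) (by norm_num) j).pd (k := 1) (by norm_num) i).continuous
  have cF : ∀ i j, Continuous (twistedHess γ L φ i j) := fun i j => by
    unfold twistedHess; fun_prop
  have cM : Continuous (hessQuad φ L) := by unfold hessQuad; fun_prop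
  have int : ∀ I : EuclideanSpace ℝ (Fin n) → ℝ, Continuous I → (∀ x ∉ tsupport φ, I x = 0) →
      Integrable I := fun I hI hz =>
    hI.integrable_of_hasCompactSupport (HasCompactSupport.intro hφc hz)
  have i0 : Integrable (fun x => Real.exp (2 * γ * L x) * τ x ^ 2) :=
    Continuous.integrable_of_hasCompactSupport (by fun_prop)
      (HasCompactSupport.intro hτc fun x hx => by simp [image_eq_zero_of_notMem_tsupport hx])
  have i00 : Integrable (fun x => Real.exp (2 * γ * L x) *
      ((Real.exp ((p - 1) / 2 * L x) * φ x) ^ 2 + ((lap L x + dotGrad L L x) * φ x) ^ 2)) :=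
    int _ (by fun_prop) (fun x hx => by simp [z0 x hx])
  have i1 := int (fun x => Real.exp (2 * γ * L x) *
      ((γ * ((lap L x + dotGrad L L x) * φ x) + γ * (γ - 1) * (dotGrad L L x * φ x) +
        2 * γ * dotGrad L φ x + lap φ x) ^ 2 - p * (Real.exp ((p - 1) / 2 * L x) * φ x) ^ 2))
    (by fun_prop) (fun x hx => by simp [z0 x hx, zd x hx, zK x hx])
  have i2 := int (fun x => Real.exp (2 * γ * L x) * (∑ i, ∑ j, twistedHess γ L φ i j x ^ 2 -
      (γ * ((lap L x + dotGrad L L x) * φ x) + γ * (γ - 1) * (dotGrad L L x * φ x) +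
        2 * γ * dotGrad L φ x + lap φ x) ^ 2))
    (by fun_prop) (fun x hx => by simp [z0 x hx, zd x hx, zK x hx, zN _ _ x hx])
  have i3 := int (fun x => Real.exp (2 * γ * L x) *
      ((2 * γ - 1) * (2 * γ - 2) * ((dotGrad L L x * φ x) * ((lap L x + dotGrad L L x) * φ x)) +
        (2 * γ - 1) * ((lap L x + dotGrad L L x) * φ x) ^ 2 +
        4 * (2 * γ - 1) * (((lap L x + dotGrad L L x) * φ x) * dotGrad L φ x) +
        2 * ((lap L x + dotGrad L L x) * dotGrad φ φ x) +
        2 * (((lap L x + dotGrad L L x) * φ x) * lap φ x) -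
        (Real.exp ((p - 1) / 2 * L x) * φ x) ^ 2))
    (by fun_prop) (fun x hx => by simp [z0 x hx, zG x hx])
  have i4 := int (fun x => Real.exp (2 * γ * L x) * (- (dotGrad L L x * φ x) ^ 2 +
      (dotGrad L L x * φ x) * ((lap L x + dotGrad L L x) * φ x) -
      2 * ((dotGrad L L x * φ x) * dotGrad L φ x) +
      2 / γ * (φ x * ∑ i, ∑ j, twistedHess γ L φ i j x * (pd i L x * pd j L x) -
        φ x * hessQuad φ L x)))
    (by fun_prop) (fun x hx => by simp [z0 x hx])
  have i5 := int (fun x => Real.exp (2 * γ * L x) * ((Real.exp ((p - 1) / 2 * L x) * φ x) *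
      ((4 * γ - 3 + p) / 2 * (dotGrad L L x * φ x) + (lap L x + dotGrad L L x) * φ x +
        2 * dotGrad L φ x)))
    (by fun_prop) (fun x hx => by simp [z0 x hx])
  refine integral_le_of_linear_combination (m₂ := m₂) (m₃ := m₃) (m₄ := m₄)
    (m₅ := m₅) hc hm i00 i0 i1 i2 i3 i4 i5 J1 J2 J3 J4 J5 fun x => ?_
  have hA := dotGrad_self_nonneg (L := L) x
  have hb : ∀ s : ℝ, |s * φ x| = |s| * φ x := fun s => by rw [abs_mul, abs_of_nonneg (hφ0 x)]
  have hG0 := dotGrad_self_nonneg (L := φ) x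
  have hM1 : |hessQuad φ L x| ≤ dotGrad L L x * τ x := by
    refine abs_le_of_sq_le_sq ?_ (mul_nonneg hA (hτ0 x))
    have h1 := sq_sum_sum_mul_le (fun i j => pd i (pd j φ) x) (fun i => pd i L x)
    have h2 : hessQuad φ L x = ∑ i, ∑ j, pd i (pd j φ) x * (pd i L x * pd j L x) := by
      simp only [hessQuad, mul_assoc]
    rw [h2]
    refine h1.trans ?_
    rw [mul_pow, mul_comm]
    exact mul_le_mul_of_nonneg_left (hN x) (sq_nonneg _)
  have key := H (dotGrad L L x * φ x) ((lap L x + dotGrad L L x) * φ x) (dotGrad L φ x)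
    (Real.exp ((p - 1) / 2 * L x) * φ x) (τ x) (lap φ x)
    ((lap L x + dotGrad L L x) * dotGrad φ φ x)
    (φ x * ∑ i, ∑ j, twistedHess γ L φ i j x * (pd i L x * pd j L x))
    (φ x * hessQuad φ L x) (∑ i, ∑ j, twistedHess γ L φ i j x ^ 2)
    (mul_nonneg hA (hφ0 x)) (hτ0 x)
    ((sq_dotGrad_le x).trans ((mul_le_mul_of_nonneg_left (hG x) hA).trans (by rw [mul_assoc])))
    (hK x)
    (by
      rw [hb, abs_mul, abs_of_nonneg hG0, mul_assoc]
      exact mul_le_mul_of_nonneg_left (hG x) (abs_nonneg _))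
    (Finset.sum_nonneg fun _ _ => Finset.sum_nonneg fun _ _ => sq_nonneg _)
    (by
      rw [mul_pow, mul_pow, mul_comm (dotGrad L L x ^ 2), mul_left_comm]
      exact mul_le_mul_of_nonneg_left (sq_sum_sum_mul_le _ _) (sq_nonneg _))
    (by
      rw [mul_comm (φ x), hb, mul_right_comm]
      exact mul_le_mul_of_nonneg_right hM1 (hφ0 x))
    (mul_nonneg (Real.exp_pos _).le (hφ0 x)) (hR x)
  have hCC : C * τ x ^ 2 ≤ max C 0 * τ x ^ 2 :=
    mul_le_mul_of_nonneg_right (le_max_left _ _) (sq_nonneg _)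
  have key2 := mul_le_mul_of_nonneg_left (key.trans (add_le_add_left (add_le_add_left
    (add_le_add_left (add_le_add_left (sub_le_sub_right hCC _) _) _) _) _))
    (Real.exp_pos (2 * γ * L x)).le
  refine le_trans (le_of_eq ?_) (key2.trans (le_of_eq ?_)) <;> ring

end IntegralEstimate

/-! ### Cutoff functions -/

section Cutoff

variable {n : ℕ}

lemma hasDerivAt_max_pow (k : ℕ) (s : ℝ) :
    HasDerivAt (fun t : ℝ => max t 0 ^ (k + 2)) ((k + 2) * max s 0 ^ (k + 1)) s := by
  rcases lt_trichotomy s 0 with h | h | h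
  · have : (fun t : ℝ => max t 0 ^ (k + 2)) =ᶠ[nhds s] fun _ => 0 := by
      filter_upwards [Iio_mem_nhds h] with t ht
      simp [max_eq_right (Set.mem_Iio.1 ht).le]
    rw [max_eq_right h.le]
    simpa using (hasDerivAt_const s (0 : ℝ)).congr_of_eventuallyEq this
  · subst h
    simp only [max_self, ne_eq, Nat.add_eq_zero_iff, one_ne_zero, and_false, not_false_eq_true,
      zero_pow, mul_zero]
    have hO : (fun t : ℝ => max t 0 ^ (k + 2)) =O[nhds 0] fun t => ‖t - 0‖ ^ (k + 2) := by
      refine Asymptotics.IsBigO.of_bound 1 (Filter.Eventually.of_forall fun t => ?_)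
      rw [one_mul, norm_pow, norm_pow, norm_norm, sub_zero]
      refine pow_le_pow_left₀ (norm_nonneg _) ?_ _
      rw [Real.norm_eq_abs, Real.norm_eq_abs, abs_of_nonneg (le_max_right _ _)]
      exact max_le (le_abs_self t) (abs_nonneg t)
    simpa using (hO.hasFDerivAt (𝕜 := ℝ) (by omega)).hasDerivAt
  · have : (fun t : ℝ => max t 0 ^ (k + 2)) =ᶠ[nhds s] fun t => t ^ (k + 2) := by
      filter_upwards [Ioi_mem_nhds h] with t ht
      simp [max_eq_left (Set.mem_Ioi.1 ht).le]
    rw [max_eq_left h.le]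
    simpa using (hasDerivAt_pow (k + 2) s).congr_of_eventuallyEq this

lemma contDiff_max_pow (k : ℕ) : ContDiff ℝ k (fun t : ℝ => max t 0 ^ (k + 1)) := by
  induction k with
  | zero => exact contDiff_zero.2 (by fun_prop)
  | succ k ih =>
    push_cast
    rw [contDiff_succ_iff_deriv]
    refine ⟨fun s => (hasDerivAt_max_pow k s).differentiableAt, by simp, ?_⟩
    have : deriv (fun t : ℝ => max t 0 ^ (k + 1 + 1)) =
        fun s => ((k : ℝ) + 2) * max s 0 ^ (k + 1) := funext fun s => (hasDerivAt_max_pow k s).deriv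
    rw [this]
    exact contDiff_const.mul ih

/-- The cutoff `(1 - |x - x₀|² / R²)₊ ^ k`. -/
noncomputable def bump (x₀ : EuclideanSpace ℝ (Fin n)) (R : ℝ) (k : ℕ)
    (x : EuclideanSpace ℝ (Fin n)) : ℝ :=
  max (1 - ‖x - x₀‖ ^ 2 / R ^ 2) 0 ^ k

variable {x₀ x : EuclideanSpace ℝ (Fin n)} {R : ℝ} {k : ℕ}

lemma bump_nonneg : 0 ≤ bump x₀ R k x := pow_nonneg (le_max_right _ _) _

lemma bump_one_le_one : bump x₀ R 1 x ≤ 1 := by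
  rw [bump, pow_one]
  have : 0 ≤ ‖x - x₀‖ ^ 2 / R ^ 2 := by positivity
  exact max_le (by linarith) zero_le_one

lemma bump_eq_pow : bump x₀ R k x = bump x₀ R 1 x ^ k := by simp [bump]

lemma bump_succ_le : bump x₀ R (k + 1) x ≤ bump x₀ R k x := by
  rw [bump_eq_pow, bump_eq_pow (k := k), pow_succ]
  exact mul_le_of_le_one_right (pow_nonneg bump_nonneg _) bump_one_le_one

lemma bump_eq_zero (hR : 0 < R) (hk : k ≠ 0) (hx : R ≤ ‖x - x₀‖) : bump x₀ R k x = 0 := by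
  have : 1 ≤ ‖x - x₀‖ ^ 2 / R ^ 2 := by
    rw [one_le_div (by positivity)]
    exact pow_le_pow_left₀ hR.le hx 2
  rw [bump, max_eq_right (by linarith), zero_pow hk]

lemma hasCompactSupport_bump (hR : 0 < R) (hk : k ≠ 0) : HasCompactSupport (bump x₀ R k) :=
  HasCompactSupport.intro (isCompact_closedBall x₀ R) fun x hx => by
    refine bump_eq_zero hR hk ?_
    rw [Metric.mem_closedBall, dist_eq_norm, not_le] at hx
    exact hx.le

lemma contDiff_sq_dist : ContDiff ℝ (⊤ : ℕ∞)
    (fun y : EuclideanSpace ℝ (Fin n) => 1 - ‖y - x₀‖ ^ 2 / R ^ 2) :=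
  contDiff_const.sub (((contDiff_id.sub contDiff_const).norm_sq ℝ).div_const _)

lemma contDiff_bump : ContDiff ℝ k (bump x₀ R (k + 1)) :=
  (contDiff_max_pow k).comp (contDiff_sq_dist.of_le (by exact_mod_cast le_top))

lemma pd_sq_dist (i : Fin n) :
    pd i (fun y : EuclideanSpace ℝ (Fin n) => 1 - ‖y - x₀‖ ^ 2 / R ^ 2) x =
      - (2 * (x i - x₀ i) / R ^ 2) := by
  have h1 : HasFDerivAt (fun y : EuclideanSpace ℝ (Fin n) => y - x₀)
      (ContinuousLinearMap.id ℝ _) x := (hasFDerivAt_id x).sub_const x₀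
  have h2 := ((h1.norm_sq).mul_const ((R ^ 2)⁻¹)).const_sub 1
  simp only [pd, div_eq_mul_inv]
  rw [h2.fderiv]
  simp [EuclideanSpace.inner_single_right]
  ring

lemma pd_bump (i : Fin n) : pd i (bump x₀ R (k + 2)) x =
    - (2 * (k + 2) / R ^ 2) * ((x i - x₀ i) * bump x₀ R (k + 1) x) := by
  have h := pd_comp (i := i) (f := fun y => 1 - ‖y - x₀‖ ^ 2 / R ^ 2)
    (hasDerivAt_max_pow k (1 - ‖x - x₀‖ ^ 2 / R ^ 2))
    ((contDiff_sq_dist (x₀ := x₀) (R := R)).differentiable (by simp) x)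
  rw [pd_sq_dist] at h
  refine Eq.trans h ?_
  rw [bump]; ring

lemma pd_coord_sub (i j : Fin n) :
    pd i (fun y : EuclideanSpace ℝ (Fin n) => y j - x₀ j) x = if i = j then 1 else 0 := by
  have h1 : HasFDerivAt (fun y : EuclideanSpace ℝ (Fin n) => y j - x₀ j)
      (EuclideanSpace.proj j : EuclideanSpace ℝ (Fin n) →L[ℝ] ℝ) x :=
    (EuclideanSpace.proj (𝕜 := ℝ) j : EuclideanSpace ℝ (Fin n) →L[ℝ] ℝ).hasFDerivAt.sub_const _
  rw [pd, h1.fderiv]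
  simp [eq_comm]

lemma pd_pd_bump (i j : Fin n) : pd i (pd j (bump x₀ R (k + 3))) x =
    - (2 * (k + 3) / R ^ 2) * ((if i = j then 1 else 0) * bump x₀ R (k + 2) x -
      2 * (k + 2) / R ^ 2 * ((x i - x₀ i) * (x j - x₀ j)) * bump x₀ R (k + 1) x) := by
  have e : pd j (bump x₀ R (k + 3)) = fun y =>
      - (2 * (k + 3) / R ^ 2) * ((y j - x₀ j) * bump x₀ R (k + 2) y) := by
    funext y
    have := pd_bump (x₀ := x₀) (x := y) (R := R) (k := k + 1) j
    push_cast at this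
    rw [show (k : ℝ) + 1 + 2 = k + 3 by ring] at this
    exact this
  have d1 : DifferentiableAt ℝ (fun y : EuclideanSpace ℝ (Fin n) => y j - x₀ j) x :=
    ((EuclideanSpace.proj (𝕜 := ℝ) j :
      EuclideanSpace ℝ (Fin n) →L[ℝ] ℝ).differentiableAt).sub_const _
  have d2 : DifferentiableAt ℝ (bump x₀ R (k + 2)) x :=
    (contDiff_bump (k := k + 1)).differentiable (by simp) x
  rw [e, pd_const_mul _ (d1.fun_mul d2), pd_mul d1 d2, pd_coord_sub, pd_bump]
  ring

lemma abs_coord_le (i : Fin n) : |x i - x₀ i| ≤ ‖x - x₀‖ := by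
  simpa using PiLp.norm_apply_le (x - x₀) i

lemma abs_pd_pd_bump_le (hR : 0 < R) (i j : Fin n) :
    |pd i (pd j (bump x₀ R (k + 3))) x| ≤ 4 * (k + 3) ^ 2 / R ^ 2 * bump x₀ R (k + 1) x := by
  rcases le_or_gt R ‖x - x₀‖ with h | h
  · rw [pd_pd_bump, bump_eq_zero hR (by omega) h, bump_eq_zero hR (by omega) h]
    simp
  · have hb := bump_nonneg (x₀ := x₀) (x := x) (R := R) (k := k + 1)
    have hb2 := bump_nonneg (x₀ := x₀) (x := x) (R := R) (k := k + 2)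
    have hb' := bump_succ_le (x₀ := x₀) (x := x) (R := R) (k := k + 1)
    have hxy : |(x i - x₀ i) * (x j - x₀ j)| ≤ R ^ 2 := by
      rw [abs_mul, pow_two]
      exact mul_le_mul ((abs_coord_le i).trans h.le) ((abs_coord_le j).trans h.le)
        (abs_nonneg _) hR.le
    have h1 : |(if i = j then (1 : ℝ) else 0) * bump x₀ R (k + 2) x| ≤ bump x₀ R (k + 1) x := by
      split_ifs
      · rwa [one_mul, abs_of_nonneg hb2]
      · simpa using hb
    have h2 : |2 * (k + 2) / R ^ 2 * ((x i - x₀ i) * (x j - x₀ j)) * bump x₀ R (k + 1) x| ≤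
        2 * (k + 2) * bump x₀ R (k + 1) x := by
      rw [abs_mul, abs_mul, abs_of_nonneg hb, abs_of_nonneg (by positivity :
        0 ≤ 2 * ((k : ℝ) + 2) / R ^ 2)]
      refine mul_le_mul_of_nonneg_right ?_ hb
      calc _ ≤ 2 * ((k : ℝ) + 2) / R ^ 2 * R ^ 2 := by gcongr
        _ = _ := by field_simp
    rw [pd_pd_bump, abs_mul, abs_neg, abs_of_nonneg (by positivity :
      0 ≤ 2 * ((k : ℝ) + 3) / R ^ 2)]
    calc _ ≤ 2 * ((k : ℝ) + 3) / R ^ 2 * ((1 + 2 * (k + 2)) * bump x₀ R (k + 1) x) := by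
          refine mul_le_mul_of_nonneg_left ((abs_sub _ _).trans ?_) (by positivity)
          linarith
      _ ≤ 2 * ((k : ℝ) + 3) / R ^ 2 * ((2 * (k + 3)) * bump x₀ R (k + 1) x) := by
          gcongr; linarith
      _ = _ := by ring

lemma dotGrad_bump_le (hR : 0 < R) : dotGrad (bump x₀ R (k + 3)) (bump x₀ R (k + 3)) x ≤
    4 * (k + 3) ^ 2 / R ^ 2 * (bump x₀ R (k + 3) x * bump x₀ R (k + 1) x) := by
  have e : dotGrad (bump x₀ R (k + 3)) (bump x₀ R (k + 3)) x =
      4 * (k + 3) ^ 2 / R ^ 4 * ‖x - x₀‖ ^ 2 * bump x₀ R (k + 2) x ^ 2 := by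
    have := fun i => pd_bump (x₀ := x₀) (x := x) (R := R) (k := k + 1) i
    simp only [dotGrad, this, EuclideanSpace.norm_sq_eq, Finset.mul_sum, Finset.sum_mul]
    refine Finset.sum_congr rfl fun i _ => ?_
    push_cast
    rw [PiLp.sub_apply, Real.norm_eq_abs, sq_abs]
    ring
  have e2 : bump x₀ R (k + 3) x * bump x₀ R (k + 1) x = bump x₀ R (k + 2) x ^ 2 := by
    rw [bump_eq_pow, bump_eq_pow (k := k + 1), bump_eq_pow (k := k + 2)]; ring
  rw [e, e2]
  rcases le_or_gt R ‖x - x₀‖ with h | h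
  · rw [bump_eq_zero hR (by omega) h]; simp
  · refine mul_le_mul_of_nonneg_right ?_ (sq_nonneg _)
    calc _ ≤ 4 * ((k : ℝ) + 3) ^ 2 / R ^ 4 * R ^ 2 := by gcongr
      _ = _ := by field_simp

lemma lap_bump_eq : lap (bump x₀ R (k + 3)) x = ∑ i, pd i (pd i (bump x₀ R (k + 3))) x := by
  rw [lap_eq_sum_pd ((contDiff_bump (k := k + 2)).of_le (by exact_mod_cast (by omega)))]

lemma abs_lap_bump_le (hR : 0 < R) : |lap (bump x₀ R (k + 3)) x| ≤
    4 * (k + 3) ^ 2 * (n + 1) / R ^ 2 * bump x₀ R (k + 1) x := by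
  have hb := bump_nonneg (x₀ := x₀) (x := x) (R := R) (k := k + 1)
  rw [lap_bump_eq]
  refine (Finset.abs_sum_le_sum_abs _ _).trans ?_
  refine (Finset.sum_le_sum fun i _ => abs_pd_pd_bump_le hR i i).trans ?_
  rw [Finset.sum_const, Finset.card_univ, Fintype.card_fin, nsmul_eq_mul, ← mul_assoc]
  refine mul_le_mul_of_nonneg_right ?_ hb
  rw [← mul_div_assoc]
  refine div_le_div_of_nonneg_right ?_ (sq_nonneg _)
  nlinarith [sq_nonneg ((k : ℝ) + 3)]

lemma sum_sq_pd_pd_bump_le (hR : 0 < R) :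
    ∑ i, ∑ j, pd i (pd j (bump x₀ R (k + 3))) x ^ 2 ≤
      (4 * (k + 3) ^ 2 * (n + 1) / R ^ 2 * bump x₀ R (k + 1) x) ^ 2 := by
  have hb := bump_nonneg (x₀ := x₀) (x := x) (R := R) (k := k + 1)
  have h1 : ∀ i j, pd i (pd j (bump x₀ R (k + 3))) x ^ 2 ≤
      (4 * (k + 3) ^ 2 / R ^ 2 * bump x₀ R (k + 1) x) ^ 2 := fun i j =>
    sq_le_sq' (by linarith [(abs_le.1 (abs_pd_pd_bump_le (x₀ := x₀) (x := x) (k := k) hR i j)).1])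
      (abs_le.1 (abs_pd_pd_bump_le hR i j)).2
  refine (Finset.sum_le_sum fun i _ => Finset.sum_le_sum fun j _ => h1 i j).trans ?_
  simp only [Finset.sum_const, Finset.card_univ, Fintype.card_fin, nsmul_eq_mul]
  have e : 4 * ((k : ℝ) + 3) ^ 2 * (n + 1) / R ^ 2 * bump x₀ R (k + 1) x =
      (n + 1) * (4 * (k + 3) ^ 2 / R ^ 2 * bump x₀ R (k + 1) x) := by ring
  rw [e, mul_pow ((n : ℝ) + 1), ← mul_assoc (n : ℝ)]
  refine mul_le_mul_of_nonneg_right ?_ (sq_nonneg _)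
  nlinarith [(Nat.cast_nonneg n : (0 : ℝ) ≤ (n : ℝ))]

end Cutoff

section ScaledEstimate

variable {n : ℕ} {p γ : ℝ}

/-- The weighted Young inequality that absorbs the cutoff terms. -/
lemma young_scaling {s T h ρ ε : ℝ} {k : ℕ} (hs : 0 < s) (hk : 4 * s ≤ 2 * k + 2) (hT : 0 < T)
    (hh : 0 ≤ h) (hh1 : h ≤ 1) (hρ : 0 < ρ) (hε : 0 < ε) :
    T ^ s * (ρ * h ^ (2 * k + 2)) ≤
      ε * (T ^ s * (T * h ^ (2 * k + 6))) + ε⁻¹ ^ s * ρ ^ (s + 1) := by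
  have hTs : 0 < T ^ s := rpow_pos_of_pos hT s
  have hpos : 0 ≤ ε⁻¹ ^ s * ρ ^ (s + 1) := by positivity
  have hpos2 : 0 ≤ ε * (T ^ s * (T * h ^ (2 * k + 6))) := by positivity
  rcases le_or_gt ρ (ε * (T * h ^ 4)) with hc | hc
  · have h1 : ρ * h ^ (2 * k + 2) ≤ ε * (T * h ^ 4) * h ^ (2 * k + 2) :=
      mul_le_mul_of_nonneg_right hc (by positivity)
    have h2 := mul_le_mul_of_nonneg_left h1 hTs.le
    have h3 : T ^ s * (ε * (T * h ^ 4) * h ^ (2 * k + 2)) =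
      ε * (T ^ s * (T * h ^ (2 * k + 6))) := by ring
    linarith
  · have h1 : T * h ^ 4 ≤ ε⁻¹ * ρ := by
      rw [inv_mul_eq_div, le_div_iff₀ hε]; linarith
    have h2 : (T * h ^ 4) ^ s ≤ (ε⁻¹ * ρ) ^ s := rpow_le_rpow (by positivity) h1 hs.le
    rw [mul_rpow hT.le (by positivity), mul_rpow (by positivity) hρ.le] at h2
    have h3 : h ^ (2 * k + 2) ≤ (h ^ 4) ^ s := by
      rw [← rpow_natCast h 4, ← rpow_mul hh, ← rpow_natCast]
      rcases hh.eq_or_lt with h0 | h0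
      · rw [← h0, zero_rpow (by positivity)]
        positivity
      · exact rpow_le_rpow_of_exponent_ge h0 hh1 (by push_cast; linarith)
    have h4 : T ^ s * h ^ (2 * k + 2) ≤ ε⁻¹ ^ s * ρ ^ s :=
      (mul_le_mul_of_nonneg_left h3 hTs.le).trans h2
    have h5 := mul_le_mul_of_nonneg_right h4 hρ.le
    rw [rpow_add hρ, rpow_one]
    linarith

lemma CoreEstimate.scaled_integral_le {S : ℝ → ℝ → Prop} (hcore : CoreEstimate p γ S)
    (hp : 1 < p) (hγ : 0 < γ) :
    ∃ (k : ℕ) (C : ℝ), ∀ L : EuclideanSpace ℝ (Fin n) → ℝ, ContDiff ℝ 4 L →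
      (∀ x, lap (lap (fun y => Real.exp (L y))) x = Real.exp (p * L x)) →
      (∀ φ : EuclideanSpace ℝ (Fin n) → ℝ, ContDiff ℝ (⊤ : ℕ∞) φ → HasCompactSupport φ →
        ∫ x, p * Real.exp ((p - 1) * L x) * φ x ^ 2 ≤ ∫ x, (lap φ x) ^ 2) →
      (∀ x s, 0 ≤ s → S ((lap L x + dotGrad L L x) * s) (Real.exp ((p - 1) / 2 * L x) * s)) →
      ∀ x₀ R, 0 < R →
      ∫ x, Real.exp (2 * γ * L x) * ((Real.exp ((p - 1) / 2 * L x) * bump x₀ R (k + 3) x) ^ 2 +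
        ((lap L x + dotGrad L L x) * bump x₀ R (k + 3) x) ^ 2) ≤
        C * (R ^ n * ((R ^ 4)⁻¹) ^ (2 * γ / (p - 1) + 1)) := by
  have hp1 : 0 < p - 1 := sub_pos.2 hp
  set s := 2 * γ / (p - 1) with hs_def
  have hs : 0 < s := by positivity
  obtain ⟨k, hk⟩ := exists_nat_ge (max (4 * s) 1)
  have hk1 : 1 ≤ k := by exact_mod_cast (le_max_right _ _).trans hk
  replace hk := (le_max_left _ _).trans hk
  obtain ⟨C₀, hC₀, H⟩ := hcore.integral_le (n := n) hγ.ne'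
  set K : ℝ := 4 * (k + 3) ^ 2 * (n + 1) with hK
  set ε : ℝ := (2 * (C₀ * K ^ 2 + 1))⁻¹ with hε
  have hε0 : 0 < ε := by positivity
  set V : ℝ := volume.real (Metric.closedBall (0 : EuclideanSpace ℝ (Fin n)) 1) with hV
  refine ⟨k, 2 * (C₀ * K ^ 2 * (ε⁻¹ ^ s * V)), ?_⟩
  intro L hL heq hstab hS x₀ R hR
  set φ := bump x₀ R (k + 3) with hφ
  set τ : EuclideanSpace ℝ (Fin n) → ℝ := fun x => K / R ^ 2 * bump x₀ R (k + 1) x with hτ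
  have hφd : ContDiff ℝ 3 φ :=
    (contDiff_bump (k := k + 2)).of_le (by exact_mod_cast (by omega : 3 ≤ k + 2))
  have hφc : HasCompactSupport φ := hasCompactSupport_bump hR (by omega)
  have hτc : HasCompactSupport τ := (hasCompactSupport_bump hR (by omega)).mul_left
  have hτcont : Continuous τ := continuous_const.mul (contDiff_bump (k := k)).continuous
  have hK0 : 0 ≤ K := by positivity
  have main := H L φ τ hL heq hstab hφd hφc (fun x => bump_nonneg) hτcont hτc
    (fun x => mul_nonneg (by positivity) bump_nonneg)
    (fun x => by
      refine (dotGrad_bump_le hR).trans ?_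
      simp only [hτ, hφ]
      rw [mul_left_comm (bump x₀ R (k + 3) x)]
      refine mul_le_mul_of_nonneg_right ?_ (mul_nonneg bump_nonneg bump_nonneg)
      refine div_le_div_of_nonneg_right ?_ (sq_nonneg _)
      exact le_mul_of_one_le_right (by positivity) (by simp))
    (fun x => abs_lap_bump_le hR) (fun x => sum_sq_pd_pd_bump_le hR)
    (fun x => hS x _ bump_nonneg)
  set I := ∫ x, Real.exp (2 * γ * L x) * ((Real.exp ((p - 1) / 2 * L x) * φ x) ^ 2 +
    ((lap L x + dotGrad L L x) * φ x) ^ 2) with hI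
  have cL := hL.continuous
  have cφ := hφd.continuous
  have cA : Continuous (dotGrad L L) := (hL.dotGrad (k := 3) hL (by norm_num)).continuous
  have cS : Continuous (lap L) := (hL.lap (k := 2) (by norm_num)).continuous
  have iI : Integrable (fun x => Real.exp (2 * γ * L x) *
      ((Real.exp ((p - 1) / 2 * L x) * φ x) ^ 2 + ((lap L x + dotGrad L L x) * φ x) ^ 2)) :=
    Continuous.integrable_of_hasCompactSupport (by fun_prop)
      (HasCompactSupport.intro hφc fun x hx => by simp [image_eq_zero_of_notMem_tsupport hx])
  have iτ : Integrable (fun x => Real.exp (2 * γ * L x) * τ x ^ 2) :=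
    Continuous.integrable_of_hasCompactSupport (by fun_prop)
      (HasCompactSupport.intro hτc fun x hx => by simp [image_eq_zero_of_notMem_tsupport hx])
  have iB : Integrable ((Metric.closedBall x₀ R).indicator
      (fun _ => ε⁻¹ ^ s * ((R ^ 4)⁻¹) ^ (s + 1))) :=
    (integrable_indicator_iff measurableSet_closedBall).2
      (integrableOn_const (isCompact_closedBall x₀ R).measure_lt_top.ne)
  have hpt : ∀ x, Real.exp (2 * γ * L x) * τ x ^ 2 ≤ K ^ 2 * ε * (Real.exp (2 * γ * L x) *
      ((Real.exp ((p - 1) / 2 * L x) * φ x) ^ 2 + ((lap L x + dotGrad L L x) * φ x) ^ 2)) +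
      K ^ 2 * (Metric.closedBall x₀ R).indicator
        (fun _ => ε⁻¹ ^ s * ((R ^ 4)⁻¹) ^ (s + 1)) x := by
    intro x
    by_cases hx : x ∈ Metric.closedBall x₀ R
    · rw [Set.indicator_of_mem hx]
      have hy := young_scaling (k := k) hs (by linarith) (exp_pos ((p - 1) * L x))
        (bump_nonneg (x₀ := x₀) (R := R) (k := 1) (x := x)) bump_one_le_one
        (by positivity : 0 < (R ^ 4)⁻¹) hε0
      have e1 : Real.exp ((p - 1) * L x) ^ s = Real.exp (2 * γ * L x) := by
        rw [← Real.exp_mul, hs_def]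
        congr 1
        field_simp
      have e2 : Real.exp ((p - 1) * L x) = Real.exp ((p - 1) / 2 * L x) ^ 2 := by
        rw [pow_two, ← Real.exp_add]; ring_nf
      rw [e1] at hy
      have h1 := mul_le_mul_of_nonneg_left hy (sq_nonneg K)
      have h2 : Real.exp (2 * γ * L x) * τ x ^ 2 = K ^ 2 * (Real.exp (2 * γ * L x) *
          ((R ^ 4)⁻¹ * bump x₀ R 1 x ^ (2 * k + 2))) := by
        simp only [hτ]
        rw [bump_eq_pow (k := k + 1)]
        field_simp
        ring
      have h3 : Real.exp (2 * γ * L x) *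
          (Real.exp ((p - 1) * L x) * bump x₀ R 1 x ^ (2 * k + 6)) ≤ Real.exp (2 * γ * L x) *
          ((Real.exp ((p - 1) / 2 * L x) * φ x) ^ 2 +
            ((lap L x + dotGrad L L x) * φ x) ^ 2) := by
        refine mul_le_mul_of_nonneg_left ?_ (Real.exp_pos _).le
        have : Real.exp ((p - 1) * L x) * bump x₀ R 1 x ^ (2 * k + 6) =
            (Real.exp ((p - 1) / 2 * L x) * φ x) ^ 2 := by
          rw [hφ, bump_eq_pow (k := k + 3), e2]; ring
        rw [this]
        exact le_add_of_nonneg_right (sq_nonneg _)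
      have h4 := mul_le_mul_of_nonneg_left h3 (by positivity : 0 ≤ K ^ 2 * ε)
      rw [h2]
      linarith
    · rw [Set.indicator_of_notMem hx]
      have : τ x = 0 := by
        rw [Metric.mem_closedBall, dist_eq_norm, not_le] at hx
        simp only [hτ]
        rw [bump_eq_zero hR (by omega) hx.le, mul_zero]
      rw [this]
      simp only [ne_eq, OfNat.ofNat_ne_zero, not_false_eq_true, zero_pow, mul_zero, add_zero]
      have := Real.exp_pos (2 * γ * L x)
      positivity
  have h_int := integral_mono iτ ((iI.const_mul (K ^ 2 * ε)).add (iB.const_mul (K ^ 2))) hpt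
  simp only [Pi.add_apply] at h_int
  rw [integral_add (iI.const_mul _) (iB.const_mul _), integral_const_mul, integral_const_mul,
    integral_indicator measurableSet_closedBall, setIntegral_const,
    Measure.addHaar_real_closedBall' _ _ hR.le, finrank_euclideanSpace_fin, ← hI, ← hV,
    smul_eq_mul] at h_int
  have h6 := main.trans (mul_le_mul_of_nonneg_left h_int hC₀)
  have h7 : C₀ * K ^ 2 * ε ≤ 1 / 2 := by
    rw [hε, ← div_eq_mul_inv, div_le_div_iff₀ (by positivity) (by norm_num)]
    linarith
  have hI0 : 0 ≤ I := integral_nonneg fun x => by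
    have := Real.exp_pos (2 * γ * L x)
    positivity
  have h8 := mul_le_mul_of_nonneg_right h7 hI0
  linarith

end ScaledEstimate

/-! ### The mean value inequality -/

section MeanValue

variable {n : ℕ} {z : EuclideanSpace ℝ (Fin n) → ℝ}

lemma pd_comp_add_smul {f : EuclideanSpace ℝ (Fin n) → ℝ} (hf : Differentiable ℝ f)
    (x₀ : EuclideanSpace ℝ (Fin n)) (r : ℝ) (i : Fin n) (y : EuclideanSpace ℝ (Fin n)) :
    pd i (fun y => f (x₀ + r • y)) y = r * pd i f (x₀ + r • y) := by
  have h1 : HasFDerivAt (fun y : EuclideanSpace ℝ (Fin n) => x₀ + r • y)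
      (r • ContinuousLinearMap.id ℝ _) y := ((hasFDerivAt_id y).const_smul r).const_add x₀
  have h2 := (hf (x₀ + r • y)).hasFDerivAt.comp y h1
  rw [pd, show (fun y => f (x₀ + r • y)) = f ∘ fun y => x₀ + r • y from rfl, h2.fderiv]
  simp [pd]

lemma fderiv_eq_sum_pd (x v : EuclideanSpace ℝ (Fin n)) :
    fderiv ℝ z x v = ∑ i, v i * pd i z x := by
  conv_lhs => rw [← (EuclideanSpace.basisFun (Fin n) ℝ).sum_repr v]
  simp [pd]

lemma hasDerivAt_integral_dilation (hz : ContDiff ℝ 1 z) {ρ : EuclideanSpace ℝ (Fin n) → ℝ}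
    (hρ : Continuous ρ) (hc : HasCompactSupport ρ) (x₀ : EuclideanSpace ℝ (Fin n)) (r₀ : ℝ) :
    HasDerivAt (fun r : ℝ => ∫ y, z (x₀ + r • y) * ρ y)
      (∫ y, fderiv ℝ z (x₀ + r₀ • y) y * ρ y) r₀ := by
  have cz := hz.continuous
  have cdz : Continuous (fderiv ℝ z) := hz.continuous_fderiv (by norm_num)
  have cF : Continuous fun q : ℝ × EuclideanSpace ℝ (Fin n) =>
      fderiv ℝ z (x₀ + q.1 • q.2) q.2 * ρ q.2 :=
    ((cdz.comp (by fun_prop)).clm_apply continuous_snd).mul (hρ.comp continuous_snd)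
  obtain ⟨C, hC⟩ := ((isCompact_closedBall r₀ 1).prod hc.isCompact).exists_bound_of_continuousOn
    cF.continuousOn
  have hbound : Integrable ((tsupport ρ).indicator fun _ => C) :=
    (integrable_indicator_iff (isClosed_tsupport ρ).measurableSet).2
      (integrableOn_const hc.isCompact.measure_lt_top.ne)
  refine (hasDerivAt_integral_of_dominated_loc_of_deriv_le (μ := volume)
    (F := fun (r : ℝ) y => z (x₀ + r • y) * ρ y)
    (F' := fun r y => fderiv ℝ z (x₀ + r • y) y * ρ y)
    (Metric.ball_mem_nhds r₀ one_pos) (Filter.Eventually.of_forall fun r => ?_) ?_ ?_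
    (Filter.Eventually.of_forall fun y r hr => ?_) hbound
    (Filter.Eventually.of_forall fun y r _ => ?_)).2
  · exact Continuous.aestronglyMeasurable (by fun_prop)
  · exact Continuous.integrable_of_hasCompactSupport (by fun_prop) hc.mul_left
  · exact (cF.comp (by fun_prop : Continuous fun y => (r₀, y))).aestronglyMeasurable
  · by_cases hy : y ∈ tsupport ρ
    · rw [Set.indicator_of_mem hy]
      exact hC (r, y) ⟨Metric.ball_subset_closedBall hr, hy⟩
    · rw [Set.indicator_of_notMem hy, image_eq_zero_of_notMem_tsupport hy]
      simp
  · have h1 : HasDerivAt (fun r : ℝ => x₀ + r • y) y r := by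
      simpa using ((hasDerivAt_id r).smul_const y).const_add x₀
    exact (((hz.differentiable (by norm_num) _).hasFDerivAt.comp_hasDerivAt r h1).mul_const _)

/-- The weighted mean value inequality for subharmonic functions. -/
lemma mean_value_le (hz : ContDiff ℝ 2 z) (hsub : ∀ x, 0 ≤ lap z x) (k : ℕ) (hk : 1 ≤ k)
    (x₀ : EuclideanSpace ℝ (Fin n)) {R : ℝ} (hR : 0 ≤ R) :
    z x₀ * ∫ y, bump (0 : EuclideanSpace ℝ (Fin n)) 1 (k + 1) y ≤
      ∫ y, z (x₀ + R • y) * bump 0 1 (k + 1) y := by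
  set ρ := bump (0 : EuclideanSpace ℝ (Fin n)) 1 (k + 1)
  set P := bump (0 : EuclideanSpace ℝ (Fin n)) 1 (k + 2)
  have hρ : Continuous ρ := (contDiff_bump (k := k)).continuous
  have hρc : HasCompactSupport ρ := hasCompactSupport_bump one_pos (by omega)
  have hP : ContDiff ℝ 1 P :=
    (contDiff_bump (k := k + 1)).of_le (by exact_mod_cast (by omega : 1 ≤ k + 1))
  have hPc : HasCompactSupport P := hasCompactSupport_bump one_pos (by omega)
  have hderiv := hasDerivAt_integral_dilation (hz.of_le (by norm_num)) hρ hρc x₀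
  have hnonneg : ∀ r : ℝ, 0 ≤ r → 0 ≤ ∫ y, fderiv ℝ z (x₀ + r • y) y * ρ y := by
    intro r hr
    have e1 : ∀ y, fderiv ℝ z (x₀ + r • y) y * ρ y =
        ∑ i, -(2 * (k + 2) : ℝ)⁻¹ * (pd i z (x₀ + r • y) * pd i P y) := by
      intro y
      rw [fderiv_eq_sum_pd, Finset.sum_mul]
      refine Finset.sum_congr rfl fun i _ => ?_
      rw [pd_bump]
      simp only [ρ, PiLp.zero_apply]
      have : ((k : ℝ) + 2) ≠ 0 := by positivity
      field_simp
      simp only [sub_zero]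
      ring
    have hg : ∀ i, ContDiff ℝ 1 fun y => pd i z (x₀ + r • y) := fun i =>
      (hz.pd (k := 1) (by norm_num) i).comp (by fun_prop)
    have e2 : ∀ i, ∫ y, pd i z (x₀ + r • y) * pd i P y =
        - (r * ∫ y, pd i (pd i z) (x₀ + r • y) * P y) := by
      intro i
      rw [integral_mul_pd (hg i) hP (Or.inr hPc), ← integral_const_mul]
      congr 2
      funext y
      rw [pd_comp_add_smul ((hz.pd (k := 1) (by norm_num) i).differentiable (by norm_num))]
      ring
    have i1 : ∀ i, Integrable fun y => pd i z (x₀ + r • y) * pd i P y := fun i =>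
      ((hg i).continuous.mul (hP.pd (k := 0) (by norm_num) i).continuous
        ).integrable_of_hasCompactSupport (hPc.pd i).mul_left
    have i2 : ∀ i, Integrable fun y => pd i (pd i z) (x₀ + r • y) * P y := fun i =>
      ((((hz.pd (k := 1) (by norm_num) i).pd (k := 0) (by norm_num) i).continuous.comp
        (by fun_prop)).mul hP.continuous).integrable_of_hasCompactSupport hPc.mul_left
    rw [integral_congr_ae (Filter.Eventually.of_forall e1),
      integral_finsetSum _ fun i _ => (i1 i).const_mul _]
    simp only [integral_const_mul, e2]
    simp only [mul_neg, neg_mul, neg_neg]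
    rw [← Finset.mul_sum, ← Finset.mul_sum, ← integral_finsetSum _ fun i _ => i2 i]
    refine mul_nonneg (by positivity) (mul_nonneg hr (integral_nonneg fun y => ?_))
    rw [Pi.zero_apply, ← Finset.sum_mul]
    refine mul_nonneg ?_ bump_nonneg
    have := hsub (x₀ + r • y)
    rwa [lap_eq_sum_pd hz] at this
  have hmono : MonotoneOn (fun r : ℝ => ∫ y, z (x₀ + r • y) * ρ y) (Set.Ici 0) :=
    monotoneOn_of_deriv_nonneg (convex_Ici 0)
      (fun r _ => (hderiv r).continuousAt.continuousWithinAt)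
      (fun r _ => (hderiv r).differentiableAt.differentiableWithinAt)
      (fun r hr => by
        rw [(hderiv r).deriv]
        exact hnonneg r (interior_subset hr))
  have := hmono Set.self_mem_Ici hR hR
  simpa [integral_const_mul] using this

lemma bump_add_smul {x₀ y : EuclideanSpace ℝ (Fin n)} {R : ℝ} (hR : 0 < R) (k : ℕ) :
    bump x₀ R k (x₀ + R • y) = bump 0 1 k y := by
  simp only [bump, add_sub_cancel_left, norm_smul, Real.norm_eq_abs, abs_of_pos hR, sub_zero]
  field_simp

lemma integral_comp_add_smul (f : EuclideanSpace ℝ (Fin n) → ℝ)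
    (x₀ : EuclideanSpace ℝ (Fin n)) {R : ℝ} (hR : 0 < R) :
    ∫ y, f (x₀ + R • y) = (R ^ n)⁻¹ * ∫ x, f x := by
  rw [Measure.integral_comp_smul volume (fun y => f (x₀ + y)), integral_add_left_eq_self,
    finrank_euclideanSpace_fin, abs_of_pos (by positivity), smul_eq_mul]

lemma integral_bump_pos (k : ℕ) :
    0 < ∫ y, bump (0 : EuclideanSpace ℝ (Fin n)) 1 (k + 1) y :=
  (contDiff_bump (k := k)).continuous.integral_pos_of_hasCompactSupport_nonneg_nonzero
    (hasCompactSupport_bump one_pos (by omega)) (fun _ => bump_nonneg) (x := 0) (by simp [bump])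

/-- A subharmonic function whose weighted quadratic means vanish at infinity is nonpositive. -/
lemma nonpos_of_subharmonic (hz : ContDiff ℝ 2 z) (hsub : ∀ x, 0 ≤ lap z x) {k : ℕ} {C θ : ℝ}
    (hθ : 0 < θ) (h_int : ∀ x₀ R, 0 < R →
      (R ^ n)⁻¹ * ∫ x, (z x * bump x₀ R (k + 1) x) ^ 2 ≤ C * (R⁻¹) ^ θ)
    (x₀ : EuclideanSpace ℝ (Fin n)) : z x₀ ≤ 0 := by
  refine le_of_forall_gt_imp_ge_of_dense fun δ hδ => ?_
  have e : 2 * (k + 1) = (2 * k + 1) + 1 := by ring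
  set ρ := bump (0 : EuclideanSpace ℝ (Fin n)) 1 (2 * k + 1 + 1) with hρ_def
  have hρ : Continuous ρ := (contDiff_bump (k := 2 * k + 1)).continuous
  have hρc : HasCompactSupport ρ := hasCompactSupport_bump one_pos (by omega)
  have cz := hz.continuous
  have hpos : 0 < ∫ y, ρ y := integral_bump_pos (2 * k + 1)
  have key : ∀ R : ℝ, 0 < R → z x₀ * ∫ y, ρ y ≤ δ * (∫ y, ρ y) + (4 * δ)⁻¹ * (C * (R⁻¹) ^ θ) := by
    intro R hR
    refine (mean_value_le hz hsub (2 * k + 1) (by omega) x₀ hR.le).trans ?_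
    have i1 : Integrable fun y => z (x₀ + R • y) * ρ y :=
      Continuous.integrable_of_hasCompactSupport (by fun_prop) hρc.mul_left
    have i2 : Integrable ρ := hρ.integrable_of_hasCompactSupport hρc
    have i3 : Integrable fun y => z (x₀ + R • y) ^ 2 * ρ y :=
      Continuous.integrable_of_hasCompactSupport (by fun_prop) hρc.mul_left
    have h1 := integral_mono i1 ((i2.const_mul δ).add (i3.const_mul (4 * δ)⁻¹)) (fun y => by
      have h := mul_nonneg (bump_nonneg : 0 ≤ ρ y)
        (mul_nonneg (inv_nonneg.2 (by positivity : 0 ≤ 4 * δ)) (sq_nonneg (z (x₀ + R • y) - 2 * δ)))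
      have e : ρ y * ((4 * δ)⁻¹ * (z (x₀ + R • y) - 2 * δ) ^ 2) =
          (δ * ρ y + (4 * δ)⁻¹ * (z (x₀ + R • y) ^ 2 * ρ y)) - z (x₀ + R • y) * ρ y := by
        field_simp
        ring
      simp only [Pi.add_apply]
      linarith)
    simp only [Pi.add_apply] at h1
    rw [integral_add (i2.const_mul _) (i3.const_mul _), integral_const_mul,
      integral_const_mul] at h1
    refine h1.trans (add_le_add_right (mul_le_mul_of_nonneg_left ?_ (by positivity)) _)
    refine le_trans (le_of_eq ?_) (h_int x₀ R hR)
    rw [← integral_comp_add_smul _ x₀ hR]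
    congr 1
    funext y
    rw [bump_add_smul hR, hρ_def, bump_eq_pow, bump_eq_pow (k := k + 1)]
    ring
  have hlim : Filter.Tendsto (fun R : ℝ => δ * (∫ y, ρ y) + (4 * δ)⁻¹ * (C * (R⁻¹) ^ θ))
      Filter.atTop (nhds (δ * (∫ y, ρ y) + (4 * δ)⁻¹ * (C * 0))) := by
    have h0 := tendsto_inv_atTop_zero (𝕜 := ℝ)
    have h1 := h0.rpow_const (p := θ) (Or.inr hθ.le)
    rw [zero_rpow hθ.ne'] at h1
    exact ((h1.const_mul C).const_mul _).const_add _
  have h2 := ge_of_tendsto hlim ((Filter.eventually_gt_atTop 0).mono key)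
  rw [mul_zero, mul_zero, add_zero] at h2
  exact le_of_mul_le_mul_right h2 hpos

end MeanValue

section Superharmonic

variable {n : ℕ} {p : ℝ} {L : EuclideanSpace ℝ (Fin n) → ℝ}

lemma coreEstimate_one (hp : 1 < p) : CoreEstimate p 1 (fun _ _ => True) := by
  obtain ⟨c, C, m, m₂, m₃, m₄, hc, hm, H⟩ := pointwise_core_one hp
  refine ⟨c, C, m, m₂, m₃, m₄, 0, hc, hm, ?_⟩
  intro X b d y τ K e Φ M N hX hτ hd hK he hN hΦ hM _ _
  refine (H X b d y τ K e Φ M N hX hτ hd hK he hN hΦ hM).trans (le_of_eq ?_)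
  ring

/-- A stable solution `u = exp L` satisfies `Δu ≤ 0`. -/
lemma lap_exp_nonpos (hp : 1 < p) (hL : ContDiff ℝ 4 L)
    (heq : ∀ x, lap (lap (fun y => Real.exp (L y))) x = Real.exp (p * L x))
    (hstab : ∀ φ : EuclideanSpace ℝ (Fin n) → ℝ, ContDiff ℝ (⊤ : ℕ∞) φ → HasCompactSupport φ →
      ∫ x, p * Real.exp ((p - 1) * L x) * φ x ^ 2 ≤ ∫ x, (lap φ x) ^ 2)
    (x₀ : EuclideanSpace ℝ (Fin n)) : lap (fun y => Real.exp (L y)) x₀ ≤ 0 := by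
  obtain ⟨k, C, H⟩ := (coreEstimate_one hp).scaled_integral_le (n := n) hp one_pos
  have hp1 : 0 < p - 1 := sub_pos.2 hp
  have hθ : 0 < 4 * (2 * 1 / (p - 1) + 1) := by positivity
  have hz : ContDiff ℝ 2 (lap fun y => Real.exp (L y)) :=
    (Real.contDiff_exp.comp hL).lap (k := 2) (by norm_num)
  refine nonpos_of_subharmonic hz (fun x => (heq x).symm ▸ (Real.exp_pos _).le)
    (k := k + 2) (C := C) hθ (fun x₁ R hR => ?_) x₀
  have h := H L hL heq hstab (fun _ _ _ => trivial) x₁ R hR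
  have cL := hL.continuous
  have cA : Continuous (dotGrad L L) := (hL.dotGrad (k := 3) hL (by norm_num)).continuous
  have cS : Continuous (lap L) := (hL.lap (k := 2) (by norm_num)).continuous
  have cb : Continuous (bump x₁ R (k + 3)) := (contDiff_bump (k := k + 2)).continuous
  have cc : HasCompactSupport (bump x₁ R (k + 3)) := hasCompactSupport_bump hR (by omega)
  have hle : ∫ x, (lap (fun y => Real.exp (L y)) x * bump x₁ R (k + 3) x) ^ 2 ≤
      C * (R ^ n * ((R ^ 4)⁻¹) ^ (2 * 1 / (p - 1) + 1)) := by
    refine le_trans (integral_mono ?_ ?_ fun x => ?_) h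
    · have := hz.continuous
      exact Continuous.integrable_of_hasCompactSupport (by fun_prop)
        (HasCompactSupport.intro cc fun x hx => by simp [image_eq_zero_of_notMem_tsupport hx])
    · exact Continuous.integrable_of_hasCompactSupport (by fun_prop)
        (HasCompactSupport.intro cc fun x hx => by simp [image_eq_zero_of_notMem_tsupport hx])
    · simp only
      rw [lap_exp (hL.of_le (by norm_num)), mul_assoc, mul_pow, ← Real.exp_nat_mul]
      push_cast
      rw [mul_one]
      exact mul_le_mul_of_nonneg_left (le_add_of_nonneg_left (sq_nonneg _)) (Real.exp_pos _).le
  have hRn : (0 : ℝ) < R ^ n := by positivity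
  have e : ((R ^ 4)⁻¹) ^ (2 * 1 / (p - 1) + 1) = (R⁻¹) ^ (4 * (2 * 1 / (p - 1) + 1)) := by
    rw [← inv_pow, rpow_mul (by positivity)]
    norm_cast
  rw [inv_mul_le_iff₀ hRn, ← e]
  linarith

end Superharmonic

/-! ### A Keller–Osserman type bound -/

section KellerOsserman

variable {n : ℕ}

lemma lap_nonpos_of_isLocalMax {f : EuclideanSpace ℝ (Fin n) → ℝ} (hf : ContDiff ℝ 2 f)
    {x : EuclideanSpace ℝ (Fin n)} (hx : IsLocalMax f x) : lap f x ≤ 0 := by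
  rw [lap_eq_sum_pd hf]
  refine Finset.sum_nonpos fun i _ => ?_
  by_contra! hpos
  set v : EuclideanSpace ℝ (Fin n) := EuclideanSpace.single i 1
  have hline : ∀ t : ℝ, HasDerivAt (fun t : ℝ => x + t • v) v t := fun t => by
    simpa using ((hasDerivAt_id t).smul_const v).const_add x
  have hcomp : ∀ g : EuclideanSpace ℝ (Fin n) → ℝ, Differentiable ℝ g →
      deriv (fun t : ℝ => g (x + t • v)) = fun t => pd i g (x + t • v) := fun g hg => by
    funext t
    exact ((hg _).hasFDerivAt.comp_hasDerivAt t (hline t)).deriv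
  have h1 := hcomp f (hf.differentiable (by norm_num))
  have h2 := hcomp (pd i f) (differentiable_pd hf i)
  have hx0 : pd i f x = 0 := by simp [pd, hx.fderiv_eq_zero]
  have hc : Continuous fun t : ℝ => x + t • v := by fun_prop
  have hmin : IsLocalMin (fun t : ℝ => f (x + t • v)) 0 := by
    refine isLocalMin_of_deriv_deriv_pos ?_ ?_ (hf.continuous.comp hc).continuousAt
    · rw [h1, h2]
      simpa using hpos
    · rw [h1]
      simpa using hx0
  have hmax : IsLocalMax (fun t : ℝ => f (x + t • v)) 0 := by
    have ht : Filter.Tendsto (fun t : ℝ => x + t • v) (nhds 0) (nhds x) := by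
      simpa using hc.tendsto 0
    have := ht.eventually hx
    simpa [IsLocalMax, IsMaxFilter] using this
  have hconst : (fun t : ℝ => f (x + t • v)) =ᶠ[nhds 0] fun _ => f (x + (0 : ℝ) • v) := by
    filter_upwards [hmin, hmax] with t h3 h4
    exact le_antisymm h4 h3
  have h3 : deriv (deriv fun t : ℝ => f (x + t • v)) 0 = 0 := by
    rw [hconst.deriv.deriv_eq]
    simp
  rw [h1, h2] at h3
  simp only [zero_smul, add_zero] at h3
  exact hpos.ne' h3

/-- A function with `ΔW ≥ c W ^ (1 + δ)` wherever it is positive is nowhere positive. -/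
lemma nonpos_of_lap_ge_rpow {W : EuclideanSpace ℝ (Fin n) → ℝ} (hW : ContDiff ℝ 2 W) {c δ : ℝ}
    (hc : 0 < c) (hδ : 0 < δ) (h : ∀ x, 0 < W x → c * W x ^ δ * W x ≤ lap W x)
    (x₀ : EuclideanSpace ℝ (Fin n)) : W x₀ ≤ 0 := by
  by_contra! h0
  obtain ⟨k, hk⟩ := exists_nat_ge (2 / δ)
  set K : ℝ := 3 * (4 * (k + 3) ^ 2 * (n + 1)) with hK
  have hK0 : 0 < K := by positivity
  have key : ∀ R : ℝ, 0 < R → c * W x₀ ^ δ * R ^ 2 ≤ K := by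
    intro R hR
    set ψ := bump x₀ R (k + 3) with hψ
    have dψ : ContDiff ℝ 2 ψ :=
      (contDiff_bump (k := k + 2)).of_le (by exact_mod_cast (by omega : 2 ≤ k + 2))
    have dF : ContDiff ℝ 2 fun x => W x * ψ x := hW.mul dψ
    obtain ⟨x, hx⟩ : ∃ x, ∀ y, W y * ψ y ≤ W x * ψ x :=
      dF.continuous.exists_forall_ge_of_hasCompactSupport
        (hasCompactSupport_bump hR (by omega)).mul_left
    have hψ0 : ψ x₀ = 1 := by simp [hψ, bump]
    have hxx : W x₀ ≤ W x * ψ x := by simpa [hψ0] using hx x₀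
    have hψx : 0 < ψ x := by
      refine lt_of_le_of_ne bump_nonneg fun he => ?_
      rw [← he, mul_zero] at hxx
      linarith
    have hWx : 0 < W x := pos_of_mul_pos_left (h0.trans_le hxx) hψx.le
    have hloc : IsLocalMax (fun x => W x * ψ x) x := Filter.Eventually.of_forall hx
    have hlap := lap_nonpos_of_isLocalMax dF hloc
    rw [lap_mul hW dψ] at hlap
    have hgrad : ψ x * dotGrad W ψ x = - (W x * dotGrad ψ ψ x) := by
      have : ∀ i, W x * pd i ψ x + ψ x * pd i W x = 0 := fun i => by
        rw [← pd_mul (hW.differentiable (by norm_num) x) (dψ.differentiable (by norm_num) x)]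
        simp [pd, hloc.fderiv_eq_zero]
      simp only [dotGrad, Finset.mul_sum, ← Finset.sum_neg_distrib]
      refine Finset.sum_congr rfl fun i _ => ?_
      linear_combination pd i ψ x * this i
    set h₁ := bump x₀ R 1 x with hh₁
    have eψ : ψ x = h₁ ^ (k + 3) := bump_eq_pow
    have e₁ : bump x₀ R (k + 1) x = h₁ ^ (k + 1) := bump_eq_pow
    have hh : 0 < h₁ := lt_of_le_of_ne bump_nonneg fun he => by
      rw [eψ, ← he, zero_pow (by omega)] at hψx
      exact hψx.false
    have b1 := abs_le.1 (abs_lap_bump_le (x₀ := x₀) (x := x) (k := k) hR)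
    have b2 := dotGrad_bump_le (x₀ := x₀) (x := x) (k := k) hR
    rw [← hψ, e₁] at b1 b2
    have b2' : dotGrad ψ ψ x ≤ 4 * (k + 3) ^ 2 * (n + 1) / R ^ 2 * (ψ x * h₁ ^ (k + 1)) := by
      refine b2.trans (mul_le_mul_of_nonneg_right ?_ (by positivity))
      refine div_le_div_of_nonneg_right ?_ (sq_nonneg _)
      exact le_mul_of_one_le_right (by positivity) (by simp)
    have h1 : ψ x * (ψ x * lap W x) ≤ W x * (K / R ^ 2 * (ψ x * h₁ ^ (k + 1))) := by
      have h2 := mul_le_mul_of_nonneg_left hlap hψx.le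
      have h3 := mul_le_mul_of_nonneg_left b2' hWx.le
      have h4 := mul_le_mul_of_nonneg_left b1.1 (mul_pos hWx hψx).le
      rw [hK]
      have e : W x * (3 * (4 * (k + 3) ^ 2 * (n + 1)) / R ^ 2 * (ψ x * h₁ ^ (k + 1))) =
        3 * (W x * (4 * (k + 3) ^ 2 * (n + 1) / R ^ 2 * (ψ x * h₁ ^ (k + 1)))) := by ring
      rw [e]
      linarith
    have h2 : (ψ x * W x * h₁ ^ (k + 1)) * (c * W x ^ δ * h₁ ^ 2) ≤
        (ψ x * W x * h₁ ^ (k + 1)) * (K / R ^ 2) := by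
      have h3 := mul_le_mul_of_nonneg_left (h x hWx) (mul_pos hψx hψx).le
      have e : (ψ x * W x * h₁ ^ (k + 1)) * (c * W x ^ δ * h₁ ^ 2) =
          ψ x * ψ x * (c * W x ^ δ * W x) := by
        rw [eψ]; ring
      rw [e]
      linarith
    have h3 := le_of_mul_le_mul_left h2 (by positivity)
    have h4 : W x₀ ^ δ ≤ W x ^ δ * h₁ ^ 2 := by
      refine (rpow_le_rpow h0.le hxx hδ.le).trans ?_
      rw [mul_rpow hWx.le hψx.le, eψ, ← rpow_natCast h₁, ← rpow_mul hh.le, ← rpow_natCast h₁ 2]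
      refine mul_le_mul_of_nonneg_left ?_ (by positivity)
      refine rpow_le_rpow_of_exponent_ge hh bump_one_le_one ?_
      rw [div_le_iff₀ hδ] at hk
      push_cast
      nlinarith
    rw [← le_div_iff₀ (by positivity)]
    refine le_trans ?_ h3
    rw [mul_assoc]
    exact mul_le_mul_of_nonneg_left h4 hc.le
  have hpos : 0 < c * W x₀ ^ δ := mul_pos hc (rpow_pos_of_pos h0 δ)
  have := key (√((K + 1) / (c * W x₀ ^ δ))) (by positivity)
  rw [Real.sq_sqrt (by positivity), mul_div_cancel₀ _ hpos.ne'] at this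
  linarith

end KellerOsserman

section PointwiseBound

variable {n : ℕ} {p : ℝ} {L : EuclideanSpace ℝ (Fin n) → ℝ}

lemma lap_add {f g : EuclideanSpace ℝ (Fin n) → ℝ} {x : EuclideanSpace ℝ (Fin n)}
    (hf : ContDiff ℝ 2 f) (hg : ContDiff ℝ 2 g) :
    lap (fun y => f y + g y) x = lap f x + lap g x := by
  rw [lap_eq_sum_pd (hf.add hg), lap_eq_sum_pd hf, lap_eq_sum_pd hg]
  simp only [← Finset.sum_add_distrib]
  refine Finset.sum_congr rfl fun i _ => ?_
  have e : pd i (fun y => f y + g y) = fun y => pd i f y + pd i g y :=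
    funext fun y => pd_add (hf.differentiable (by norm_num) y) (hg.differentiable (by norm_num) y)
  rw [e, pd_add (differentiable_pd hf i x) (differentiable_pd hg i x)]

lemma lap_exp_const_mul (hL : ContDiff ℝ 2 L) (s : ℝ) (x : EuclideanSpace ℝ (Fin n)) :
    lap (fun y => Real.exp (s * L y)) x =
      Real.exp (s * L x) * (s * (lap L x + dotGrad L L x) + s * (s - 1) * dotGrad L L x) := by
  have hd : dotGrad (fun y => s * L y) (fun y => s * L y) x = s ^ 2 * dotGrad L L x := by
    simp only [dotGrad, pd_const_mul s (hL.differentiable (by norm_num) x), Finset.mul_sum]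
    exact Finset.sum_congr rfl fun i _ => by ring
  rw [lap_exp (contDiff_const.mul hL), lap_const_mul hL, hd]
  ring

/-- Souplet's inequality `Δu ≤ -√(2 / (p + 1)) u ^ ((p + 1) / 2)` for `u = exp L` with
`Δ²u = u ^ p` and `Δu ≤ 0`, divided by `u`. -/
lemma lap_add_dotGrad_le (hp : 1 < p) (hL : ContDiff ℝ 4 L)
    (heq : ∀ x, lap (lap (fun y => Real.exp (L y))) x = Real.exp (p * L x))
    (hneg : ∀ x, lap (fun y => Real.exp (L y)) x ≤ 0) (x₀ : EuclideanSpace ℝ (Fin n)) :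
    lap L x₀ + dotGrad L L x₀ ≤ -√(2 / (p + 1)) * Real.exp ((p - 1) / 2 * L x₀) := by
  set l := √(2 / (p + 1)) with hl_def
  set s := (p + 1) / 2 with hs
  have hs0 : 1 < s := by rw [hs]; linarith
  have hl : 0 < l := Real.sqrt_pos.2 (by positivity)
  have hl2 : s * l ^ 2 = 1 := by
    rw [hl_def, Real.sq_sqrt (by positivity), hs]
    field_simp
  have hL2 : ContDiff ℝ 2 L := hL.of_le (by norm_num)
  have d1 : ContDiff ℝ 2 fun y => l * Real.exp (s * L y) :=
    contDiff_const.mul (contDiff_const.mul hL2).exp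
  have d2 : ContDiff ℝ 2 (lap fun y => Real.exp (L y)) :=
    (Real.contDiff_exp.comp hL).lap (k := 2) (by norm_num)
  set W : EuclideanSpace ℝ (Fin n) → ℝ := fun y =>
    l * Real.exp (s * L y) + lap (fun y => Real.exp (L y)) y with hW
  have hWle : ∀ x, W x ≤ l * Real.exp (s * L x) := fun x => by
    have := hneg x
    simp only [hW]
    linarith
  have hlapW : ∀ x, l * s * Real.exp ((s - 1) * L x) * W x ≤ lap W x := by
    intro x
    have e1 : lap W x = l * (Real.exp (s * L x) * (s * (lap L x + dotGrad L L x) +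
        s * (s - 1) * dotGrad L L x)) + Real.exp (p * L x) := by
      rw [hW, lap_add d1 d2, heq,
        lap_const_mul (contDiff_const.mul hL2).exp, lap_exp_const_mul hL2]
    have e2 : Real.exp (p * L x) = Real.exp ((s - 1) * L x) * Real.exp (s * L x) := by
      rw [← Real.exp_add, hs]; ring_nf
    have e3 : Real.exp (s * L x) = Real.exp ((s - 1) * L x) * Real.exp (L x) := by
      rw [← Real.exp_add]; ring_nf
    have e4 : W x = l * Real.exp (s * L x) +
        Real.exp (L x) * (lap L x + dotGrad L L x) := by
      simp only [hW]
      rw [lap_exp hL2]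
    have hA : 0 ≤ l * Real.exp (s * L x) * (s * (s - 1) * dotGrad L L x) :=
      mul_nonneg (by positivity)
        (mul_nonneg (mul_nonneg (by linarith) (by linarith)) (dotGrad_self_nonneg x))
    have e5 : lap W x - l * s * Real.exp ((s - 1) * L x) * W x =
        l * Real.exp (s * L x) * (s * (s - 1) * dotGrad L L x) := by
      rw [e1, e4, e2]
      linear_combination (-(Real.exp ((s - 1) * L x) * Real.exp (s * L x))) * hl2 +
        l * s * (lap L x + dotGrad L L x) * e3
    linarith
  have hmain : W x₀ ≤ 0 := by
    refine nonpos_of_lap_ge_rpow (d1.add d2) (c := l * s * (l⁻¹) ^ ((s - 1) / s))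
      (δ := (s - 1) / s) (by positivity) (div_pos (by linarith) (by linarith)) (fun x hx => ?_) x₀
    refine le_trans (mul_le_mul_of_nonneg_right ?_ hx.le) (hlapW x)
    rw [mul_assoc, ← mul_rpow (by positivity) hx.le]
    refine mul_le_mul_of_nonneg_left ?_ (by positivity)
    have h1 : l⁻¹ * W x ≤ Real.exp (s * L x) := by
      rw [inv_mul_le_iff₀ hl]
      exact hWle x
    refine (rpow_le_rpow (mul_nonneg (by positivity) hx.le) h1
      (div_nonneg (by linarith) (by linarith))).trans (le_of_eq ?_)
    rw [← Real.exp_mul]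
    congr 1
    field_simp
  have e3 : Real.exp (s * L x₀) = Real.exp ((p - 1) / 2 * L x₀) * Real.exp (L x₀) := by
    rw [← Real.exp_add, hs]; ring_nf
  simp only [hW] at hmain
  rw [lap_exp hL2, e3] at hmain
  refine le_of_mul_le_mul_left ?_ (Real.exp_pos (L x₀))
  linarith

end PointwiseBound

/-! ### Nonexistence -/

theorem stmt_3 (n : ℕ) (hn : 5 ≤ n) (p γ : ℝ) (hp : 1 < p)
    (hγ1 : 1 < γ) (hγ2 : γ < 3/2)
    (hE : 0 < p*(1 - 4*(γ-1)^2) - γ^2/(2*γ-1) + 8*γ^2*(γ-1)^2/((4*γ-3+p)*(p+1)))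
    (hcond : (p-1)*(n : ℝ)/4 < p + 2*γ - 1) :
    ¬ ∃ u : EuclideanSpace ℝ (Fin n) → ℝ,
      ContDiff ℝ 4 u ∧ (∀ x, 0 < u x) ∧ (∀ x, lap (lap u) x = u x ^ p) ∧
      (∀ φ : EuclideanSpace ℝ (Fin n) → ℝ, ContDiff ℝ (⊤ : ℕ∞) φ →
        HasCompactSupport φ →
        p * ∫ x, u x ^ (p - 1) * φ x ^ 2 ≤ ∫ x, (lap φ x) ^ 2) := by
  rintro ⟨u, hu, hpos, hpde, hst⟩
  set L : EuclideanSpace ℝ (Fin n) → ℝ := fun x => Real.log (u x) with hL_def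
  have hL : ContDiff ℝ 4 L := hu.log fun x => (hpos x).ne'
  have hexp : (fun y => Real.exp (L y)) = u := funext fun y => Real.exp_log (hpos y)
  have hrpow : ∀ x (t : ℝ), u x ^ t = Real.exp (t * L x) := fun x t => by
    rw [Real.rpow_def_of_pos (hpos x), mul_comm]
  have heq : ∀ x, lap (lap (fun y => Real.exp (L y))) x = Real.exp (p * L x) := fun x => by
    rw [hexp, hpde, hrpow]
  have hstab : ∀ φ : EuclideanSpace ℝ (Fin n) → ℝ, ContDiff ℝ (⊤ : ℕ∞) φ →
      HasCompactSupport φ →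
      ∫ x, p * Real.exp ((p - 1) * L x) * φ x ^ 2 ≤ ∫ x, (lap φ x) ^ 2 := fun φ h1 h2 => by
    have := hst φ h1 h2
    rw [← integral_const_mul] at this
    simpa only [hrpow, mul_assoc] using this
  have hneg := lap_exp_nonpos hp hL heq hstab
  have hcore : CoreEstimate p γ fun b y => b ≤ -√(2 / (p + 1)) * y :=
    pointwise_core hp hγ1 hγ2 hE
  have hp1 : 0 < p - 1 := sub_pos.2 hp
  have hγ0 : 0 < γ := by linarith
  obtain ⟨k, C, H⟩ := hcore.scaled_integral_le (n := n) hp hγ0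
  have H' := H L hL heq hstab (fun x s hs => by
    have := mul_le_mul_of_nonneg_right (lap_add_dotGrad_le hp hL heq hneg x) hs
    linarith) 0
  set V := fun x => Real.exp (2 * γ * L x) * Real.exp ((p - 1) / 2 * L x) ^ 2 with hV
  have cL := hL.continuous
  have cA : Continuous (dotGrad L L) := (hL.dotGrad (k := 3) hL (by norm_num)).continuous
  have cS : Continuous (lap L) := (hL.lap (k := 2) (by norm_num)).continuous
  have cV : Continuous V := by fun_prop
  have hVpos : ∀ x, 0 < V x := fun x => by positivity
  set η := fun R => bump (0 : EuclideanSpace ℝ (Fin n)) R (k + 3)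
  have cη : ∀ R, Continuous (η R) := fun R => (contDiff_bump (k := k + 2)).continuous
  have hηc : ∀ R, 0 < R → HasCompactSupport (η R) := fun R hR =>
    hasCompactSupport_bump hR (by omega)
  have iV : ∀ R, 0 < R → Integrable fun x => V x * η R x ^ 2 := fun R hR => by
    have := cη R
    exact Continuous.integrable_of_hasCompactSupport (by fun_prop)
      (HasCompactSupport.intro (hηc R hR) fun x hx => by
        simp [image_eq_zero_of_notMem_tsupport hx])
  set I := ∫ x, V x * η 1 x ^ 2 with hI
  have hIpos : 0 < I := by
    have := cη 1
    refine Continuous.integral_pos_of_hasCompactSupport_nonneg_nonzero (by fun_prop)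
      (HasCompactSupport.intro (hηc 1 one_pos) fun x hx => by
        simp [image_eq_zero_of_notMem_tsupport hx])
      (fun x => mul_nonneg (hVpos x).le (sq_nonneg _)) (x := 0) ?_
    simpa [η, bump] using (hVpos 0).ne'
  set θ := 4 * (2 * γ / (p - 1) + 1) - n with hθ_def
  have hθ : 0 < θ := by
    have : (n : ℝ) < 4 * (2 * γ / (p - 1) + 1) := by
      rw [div_add_one hp1.ne', mul_div_assoc', lt_div_iff₀ hp1]
      linarith
    rw [hθ_def]
    linarith
  have hle : ∀ R : ℝ, 1 ≤ R → I ≤ C * (R⁻¹) ^ θ := by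
    intro R hR
    have hR0 : 0 < R := by linarith
    have e : C * (R ^ n * ((R ^ 4)⁻¹) ^ (2 * γ / (p - 1) + 1)) = C * (R⁻¹) ^ θ := by
      rw [hθ_def, rpow_sub (by positivity), rpow_mul (by positivity), rpow_natCast, inv_pow R n]
      norm_cast
      rw [inv_pow]
      field_simp
    rw [← e]
    refine le_trans (integral_mono (iV 1 one_pos) (iV R hR0) fun x => ?_)
      (le_trans (integral_mono (iV R hR0) ?_ fun x => ?_) (H' R hR0))
    · have h1 : η 1 x ≤ η R x := by
        refine pow_le_pow_left₀ (le_max_right _ _) (max_le_max_right _ ?_) _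
        refine sub_le_sub_left (div_le_div_of_nonneg_left (sq_nonneg _) (by norm_num) ?_) _
        exact pow_le_pow_left₀ zero_le_one hR 2
      exact mul_le_mul_of_nonneg_left (pow_le_pow_left₀ bump_nonneg h1 2) (hVpos x).le
    · have : Continuous (bump (0 : EuclideanSpace ℝ (Fin n)) R (k + 3)) := cη R
      exact Continuous.integrable_of_hasCompactSupport (by fun_prop)
        (HasCompactSupport.intro (hηc R hR0) fun x hx => by
          have : bump 0 R (k + 3) x = 0 := image_eq_zero_of_notMem_tsupport hx
          simp [this])
    · simp only [hV]
      rw [mul_assoc, ← mul_pow]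
      exact mul_le_mul_of_nonneg_left (le_add_of_nonneg_right (sq_nonneg _)) (Real.exp_pos _).le
  have hlim : Filter.Tendsto (fun R : ℝ => C * (R⁻¹) ^ θ) Filter.atTop (nhds (C * 0)) := by
    have h1 := (tendsto_inv_atTop_zero (𝕜 := ℝ)).rpow_const (p := θ) (Or.inr hθ.le)
    rw [zero_rpow hθ.ne'] at h1
    exact h1.const_mul C
  have := ge_of_tendsto hlim ((Filter.eventually_ge_atTop 1).mono hle)
  linarith
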